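/- arXiv:2101.01146 — 5 statements merged into one kernel-verified Lean document; each statement's English description precedes it below -/
import Mathlib

section
/- There is a universal constant C > 0 such that the following holds. Let G = (V, E, w) be a weighted graph on n ≥ 2 vertices and let μ be a probability measure on V. (1) For every integer k ≥ 1 there exists a spanning clan embedding (f, χ) of G into a tree with multiplicative distortion at most C·k·(1 + log₂ log₂ n) such that E_{v∼μ}[|f(v)|] ≤ C·n^{1/k}. (2) For every ε ∈ (0,1] there exists a spanning clan embedding (f, χ) of G into a tree with multiplicative distortion at most C·(log₂ n)·(1 + log₂ log₂ n)/ε such that E_{v∼μ}[|f(v)|] ≤ 1 + ε. -/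
/-- The shortest-path metric of a weighted graph: the infimum of the total edge weight of
walks from `u` to `v`. -/
noncomputable def spDist {V : Type*} (G : SimpleGraph V) (w : Sym2 V → ℝ) (u v : V) : ℝ :=
  sInf (Set.range fun p : G.Walk u v => (p.edges.map w).sum)

/-- `(f, χ)` is a spanning clan embedding of the weighted graph `(G, wG)` into the
weighted tree `(T, wT)` with multiplicative distortion `t`. -/
def IsSpanningClanTree {V Y : Type*}
    (G : SimpleGraph V) (wG : Sym2 V → ℝ)
    (T : SimpleGraph Y) (wT : Sym2 Y → ℝ)
    (f : V → Finset Y) (χ : V → Y) (t : ℝ) : Prop :=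
  T.IsTree ∧
  (∀ e ∈ T.edgeSet, 0 < wT e) ∧
  (∀ v, (f v).Nonempty) ∧
  (∀ u v : V, u ≠ v → Disjoint (f u) (f v)) ∧
  (∀ y : Y, ∃ v : V, y ∈ f v) ∧
  (∀ (u v : V) (u' v' : Y), u' ∈ f u → v' ∈ f v → T.Adj u' v' →
      G.Adj u v ∧ wT s(u', v') = wG s(u, v)) ∧
  (∀ u v : V, u ≠ v → ∀ u' ∈ f u, ∀ v' ∈ f v, spDist G wG u v ≤ spDist T wT u' v') ∧
  (∀ v, χ v ∈ f v) ∧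
  (∀ u v : V, ∃ v' ∈ f v, spDist T wT v' (χ u) ≤ t * spDist G wG u v)

namespace Clan

set_option linter.unusedSectionVars false

open SimpleGraph

section Basic

variable {α β : Type*} {H : SimpleGraph α} {w : Sym2 α → ℝ}

/-- Total weight of a walk. -/
def wt {α : Type*} {H : SimpleGraph α} (w : Sym2 α → ℝ) {u v : α} (p : H.Walk u v) : ℝ :=
  (p.edges.map w).sum

@[simp] lemma wt_nil {u : α} : wt w (Walk.nil : H.Walk u u) = 0 := by simp [wt]

@[simp] lemma wt_cons {u v x : α} (h : H.Adj u v) (p : H.Walk v x) :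
    wt w (Walk.cons h p) = w s(u, v) + wt w p := by simp [wt]

@[simp] lemma wt_append {u v x : α} (p : H.Walk u v) (q : H.Walk v x) :
    wt w (p.append q) = wt w p + wt w q := by simp [wt]

@[simp] lemma wt_reverse {u v : α} (p : H.Walk u v) : wt w p.reverse = wt w p := by
  simp [wt, List.sum_reverse]

lemma wt_nonneg (hw : ∀ e, 0 ≤ w e) {u v : α} (p : H.Walk u v) : 0 ≤ wt w p := by
  apply List.sum_nonneg
  intro x hx
  obtain ⟨e, _, rfl⟩ := List.mem_map.1 hx
  exact hw e

lemma spd_le (hw : ∀ e, 0 ≤ w e) {u v : α} (p : H.Walk u v) : spDist H w u v ≤ wt w p := by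
  apply csInf_le
  · refine ⟨0, ?_⟩
    rintro _ ⟨q, rfl⟩
    exact wt_nonneg hw q
  · exact ⟨p, rfl⟩

lemma spd_nonneg (hw : ∀ e, 0 ≤ w e) (u v : α) : 0 ≤ spDist H w u v := by
  apply Real.sInf_nonneg
  rintro _ ⟨q, rfl⟩
  exact wt_nonneg hw q

lemma spd_self (hw : ∀ e, 0 ≤ w e) (u : α) : spDist H w u u = 0 :=
  le_antisymm (by simpa using spd_le hw (Walk.nil : H.Walk u u)) (spd_nonneg hw u u)

lemma spd_adj (hw : ∀ e, 0 ≤ w e) {u v : α} (h : H.Adj u v) : spDist H w u v ≤ w s(u, v) := by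
  simpa using spd_le hw (Walk.cons h Walk.nil)

lemma spd_exists [Finite α] (hw : ∀ e, 0 ≤ w e) {u v : α} (h : H.Reachable u v) :
    ∃ p : H.Walk u v, wt w p = spDist H w u v := by
  classical
  have := Fintype.ofFinite α
  have hne : Nonempty (H.Path u v) := by
    obtain ⟨p⟩ := h
    exact ⟨p.toPath⟩
  obtain ⟨p, hp⟩ := Finite.exists_min (fun p : H.Path u v => wt w p.1)
  refine ⟨p.1, le_antisymm ?_ (spd_le hw _)⟩
  obtain ⟨p0⟩ := h
  apply le_csInf ⟨_, Set.mem_range_self p0⟩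
  rintro _ ⟨q, rfl⟩
  refine (hp q.toPath).trans ?_
  have hs := (q.edges_bypass_sublist_edges).map w
  apply List.Sublist.sum_le_sum hs
  intro x hx
  obtain ⟨e, _, rfl⟩ := List.mem_map.1 hx
  exact hw e

lemma spd_triangle [Finite α] (hw : ∀ e, 0 ≤ w e) {u v x : α} (h : H.Reachable u v)
    (h' : H.Reachable v x) : spDist H w u x ≤ spDist H w u v + spDist H w v x := by
  obtain ⟨p, hp⟩ := spd_exists hw h
  obtain ⟨q, hq⟩ := spd_exists hw h'
  rw [← hp, ← hq, ← wt_append]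
  exact spd_le hw _

lemma spd_symm (u v : α) : spDist H w u v = spDist H w v u := by
  unfold spDist
  congr 1
  ext x
  constructor
  · rintro ⟨p, rfl⟩
    exact ⟨p.reverse, wt_reverse p⟩
  · rintro ⟨p, rfl⟩
    exact ⟨p.reverse, wt_reverse p⟩

lemma spd_map [Finite α] {H' : SimpleGraph β} {w' : Sym2 β → ℝ} (hw : ∀ e, 0 ≤ w e)
    (hw' : ∀ e, 0 ≤ w' e) (f : H →g H') (hf : ∀ a b, H.Adj a b → w' s(f a, f b) ≤ w s(a, b))
    {u v : α} (h : H.Reachable u v) : spDist H' w' (f u) (f v) ≤ spDist H w u v := by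
  obtain ⟨p, hp⟩ := spd_exists hw h
  rw [← hp]
  refine (spd_le hw' (p.map f)).trans ?_
  clear hp h
  induction p with
  | nil => simp
  | cons h p ih =>
    simp only [Walk.map_cons, wt_cons]
    exact add_le_add (hf _ _ h) ih

lemma spd_mono [Finite α] {H' : SimpleGraph α} {w' : Sym2 α → ℝ} (hw : ∀ e, 0 ≤ w e)
    (hw' : ∀ e, 0 ≤ w' e) (hle : H ≤ H') (hf : ∀ a b, H.Adj a b → w' s(a, b) ≤ w s(a, b))
    {u v : α} (h : H.Reachable u v) : spDist H' w' u v ≤ spDist H w u v :=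
  spd_map hw hw' (Hom.ofLE hle) (by simpa using hf) h

lemma spd_potential [Finite α] (hw : ∀ e, 0 ≤ w e) (f : α → ℝ)
    (hf : ∀ a b, H.Adj a b → f b - f a ≤ w s(a, b)) {u v : α} (h : H.Reachable u v) :
    f v - f u ≤ spDist H w u v := by
  obtain ⟨p, hp⟩ := spd_exists hw h
  rw [← hp]
  clear hp h
  induction p with
  | nil => simp
  | cons h p ih =>
    have := hf _ _ h
    simp only [wt_cons]
    linarith

lemma spd_lb [Finite α] (hw : ∀ e, 0 ≤ w e) {c : ℝ} (hc : ∀ e, c ≤ w e) {u v : α} (huv : u ≠ v)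
    (h : H.Reachable u v) : c ≤ spDist H w u v := by
  obtain ⟨p, hp⟩ := spd_exists hw h
  rw [← hp]
  cases p with
  | nil => exact absurd rfl huv
  | @cons _ x _ h p =>
    have h2 := wt_nonneg hw p
    simp only [wt_cons]
    linarith [hc s(u, x)]

lemma spd_pos [Finite α] (hw : ∀ e, 0 < w e) {u v : α} (huv : u ≠ v)
    (h : H.Reachable u v) : 0 < spDist H w u v := by
  obtain ⟨p, hp⟩ := spd_exists (fun e => (hw e).le) h
  rw [← hp]
  cases p with
  | nil => exact absurd rfl huv
  | @cons _ x _ h p =>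
    have h2 := wt_nonneg (fun e => (hw e).le) p
    simp only [wt_cons]
    linarith [hw s(u, x)]

end Basic

/-- The graph `G` restricted to the edges inside `S`. -/
def rg {V : Type*} (G : SimpleGraph V) (S : Finset V) : SimpleGraph V where
  Adj a b := G.Adj a b ∧ a ∈ S ∧ b ∈ S
  symm := ⟨fun _ _ h => ⟨h.1.symm, h.2.2, h.2.1⟩⟩
  loopless := ⟨fun _ h => h.1.ne rfl⟩

/-- All of `S` is connected within `S`. -/
def Conn {V : Type*} (G : SimpleGraph V) (S : Finset V) : Prop :=
  ∀ u ∈ S, ∀ v ∈ S, (rg G S).Reachable u v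

section Rg

variable {V : Type} [Finite V] {G : SimpleGraph V} {S A : Finset V} {w : Sym2 V → ℝ}

lemma rg_mono (h : A ⊆ S) : rg G A ≤ rg G S :=
  fun _ _ hab => ⟨hab.1, h hab.2.1, h hab.2.2⟩

lemma mem_of_walk {u v : V} (hu : u ∈ S) (p : (rg G S).Walk u v) : ∀ s ∈ p.support, s ∈ S := by
  induction p with
  | nil => simpa using hu
  | cons h p ih =>
    intro s hs
    rw [Walk.support_cons, List.mem_cons] at hs
    rcases hs with rfl | hs
    · exact hu
    · exact ih h.2.2 s hs

lemma stay (hw : ∀ e, 0 ≤ w e) (hS : Conn G S) {u v : V} (hu : u ∈ S) (hv : v ∈ S)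
    (hA : ∀ s ∈ S, spDist (rg G S) w u s + spDist (rg G S) w s v ≤ spDist (rg G S) w u v → s ∈ A) :
    (rg G A).Reachable u v ∧ spDist (rg G A) w u v ≤ spDist (rg G S) w u v := by
  classical
  obtain ⟨p, hp⟩ := spd_exists hw (hS u hu v hv)
  have hsup : ∀ s ∈ p.support, s ∈ A := by
    intro s hs
    apply hA s (mem_of_walk hu p s hs)
    rw [← hp]
    conv_rhs => rw [← p.take_spec hs]
    rw [wt_append]
    exact add_le_add (spd_le hw _) (spd_le hw _)
  have hed : ∀ e ∈ p.edges, e ∈ (rg G A).edgeSet := by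
    intro e he
    induction e with
    | _ a b =>
      have h1 := p.edges_subset_edgeSet he
      have h2 := hsup a (p.fst_mem_support_of_mem_edges he)
      have h3 := hsup b (p.snd_mem_support_of_mem_edges he)
      exact ⟨h1.1, h2, h3⟩
  refine ⟨⟨p.transfer _ hed⟩, ?_⟩
  refine (spd_le hw (p.transfer _ hed)).trans ?_
  simp only [wt, Walk.edges_transfer]
  exact hp.le

end Rg

section Glue

variable {Y₁ Y₂ : Type}

/-- Two graphs joined by one edge. -/
def glueT (T₁ : SimpleGraph Y₁) (T₂ : SimpleGraph Y₂) (a : Y₁) (b : Y₂) :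
    SimpleGraph (Y₁ ⊕ Y₂) :=
  (T₁ ⊕g T₂) ⊔ edge (Sum.inl a) (Sum.inr b)

variable {T₁ : SimpleGraph Y₁} {T₂ : SimpleGraph Y₂} {a : Y₁} {b : Y₂}

lemma glueT_inl {x y : Y₁} : (glueT T₁ T₂ a b).Adj (Sum.inl x) (Sum.inl y) ↔ T₁.Adj x y := by
  simp [glueT, edge_adj]

lemma glueT_inr {x y : Y₂} : (glueT T₁ T₂ a b).Adj (Sum.inr x) (Sum.inr y) ↔ T₂.Adj x y := by
  simp [glueT, edge_adj]

lemma glueT_lr {x : Y₁} {y : Y₂} :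
    (glueT T₁ T₂ a b).Adj (Sum.inl x) (Sum.inr y) ↔ x = a ∧ y = b := by
  simp [glueT, edge_adj]

/-- left inclusion -/
def glL (T₁ : SimpleGraph Y₁) (T₂ : SimpleGraph Y₂) (a : Y₁) (b : Y₂) : T₁ →g glueT T₁ T₂ a b where
  toFun := Sum.inl
  map_rel' h := glueT_inl.2 h

/-- right inclusion -/
def glR (T₁ : SimpleGraph Y₁) (T₂ : SimpleGraph Y₂) (a : Y₁) (b : Y₂) : T₂ →g glueT T₁ T₂ a b where
  toFun := Sum.inr
  map_rel' h := glueT_inr.2 h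

lemma glueT_isTree [Finite Y₁] [Finite Y₂] (h₁ : T₁.IsTree) (h₂ : T₂.IsTree) :
    (glueT T₁ T₂ a b).IsTree := by
  classical
  rw [isTree_iff_connected_and_card]
  constructor
  · have hab : (glueT T₁ T₂ a b).Reachable (Sum.inl a) (Sum.inr b) :=
      (glueT_lr.2 ⟨rfl, rfl⟩).reachable
    have key : ∀ z, (glueT T₁ T₂ a b).Reachable (Sum.inl a) z := by
      rintro (z | z)
      · exact (h₁.connected a z).map (glL T₁ T₂ a b)
      · exact hab.trans ((h₂.connected b z).map (glR T₁ T₂ a b))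
    have : Nonempty (Y₁ ⊕ Y₂) := ⟨Sum.inl a⟩
    exact ⟨fun x y => (key x).symm.trans (key y)⟩
  · have c1 := (isTree_iff_connected_and_card.1 h₁).2
    have c2 := (isTree_iff_connected_and_card.1 h₂).2
    have e1 : (glueT T₁ T₂ a b).edgeSet
        = insert s(Sum.inl a, Sum.inr b) (T₁ ⊕g T₂).edgeSet := by
      rw [glueT, edgeSet_sup, edgeSet_edge_of_ne (by simp), Set.union_comm, Set.singleton_union]
    rw [e1, Nat.card_coe_set_eq, Set.ncard_insert_of_notMem (by simp) (Set.toFinite _),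
      ← Nat.card_coe_set_eq, Nat.card_congr edgeSetSumEquiv, Nat.card_sum, Nat.card_sum]
    omega

end Glue

section Cut

lemma cut_half {k m : ℕ} (hk : 1 ≤ k) (hm : 1 ≤ m) {a : ℝ} {g : ℕ → ℝ} (hg : Monotone g)
    (h0 : 1 ≤ g 0) (hn : g (k * m) ≤ a / 2) (ha : Real.log a ≤ 2 ^ m * Real.log 2) :
    ∃ i < k * m, g (i + 1) ^ (1 + 1 / (k : ℝ)) ≤ g i * a ^ (1 / (k : ℝ)) := by
  by_contra! hcon
  have hg1 : ∀ i, 1 ≤ g i := fun i => h0.trans (hg (Nat.zero_le i))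
  have ha0 : 0 < a := by linarith [hg1 (k * m)]
  set κ : ℝ := 1 / (k : ℝ) with hκ
  have hk0 : (0 : ℝ) < k := by exact_mod_cast hk
  have hκ0 : 0 < κ := by positivity
  set L : ℕ → ℝ := fun i => Real.log a - Real.log (g i) with hL
  have hstep : ∀ i < k * m, (1 + κ) * L (i + 1) < L i := by
    intro i hi
    have h := hcon i hi
    have hgi : 0 < g i := by linarith [hg1 i]
    have hgi' : 0 < g (i + 1) := by linarith [hg1 (i + 1)]
    have h2 := Real.log_lt_log (by positivity) h
    rw [Real.log_mul (by positivity) (by positivity), Real.log_rpow ha0, Real.log_rpow hgi'] at h2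
    simp only [hL]
    nlinarith
  have hind : ∀ i ≤ k * m, (1 + κ) ^ i * L i ≤ L 0 := by
    intro i
    induction i with
    | zero => simp
    | succ i ih =>
      intro hi
      have h1 := ih (by omega)
      have h2 := hstep i (by omega)
      calc (1 + κ) ^ (i + 1) * L (i + 1) = (1 + κ) ^ i * ((1 + κ) * L (i + 1)) := by ring
        _ ≤ (1 + κ) ^ i * L i := by gcongr
        _ ≤ L 0 := h1
  have hkm : 1 ≤ k * m := Nat.mul_pos hk hm
  have hLn : Real.log 2 ≤ L (k * m) := by
    simp only [hL]
    have : 0 < g (k * m) := by linarith [hg1 (k * m)]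
    rw [← Real.log_div ha0.ne' this.ne']
    apply Real.log_le_log (by norm_num)
    rw [le_div_iff₀ this]
    linarith
  have hL0 : L 0 ≤ 2 ^ m * Real.log 2 := by
    simp only [hL]
    have := Real.log_nonneg h0
    linarith
  have hpow : (2 : ℝ) ^ m ≤ (1 + κ) ^ (k * m) := by
    rw [pow_mul]
    apply pow_le_pow_left₀ (by norm_num)
    have := one_add_mul_le_pow (a := κ) (by linarith) k
    have h3 : (k : ℝ) * κ = 1 := by rw [hκ]; field_simp
    linarith
  have hlast : (1 + κ) ^ (k * m) * L (k * m) < L 0 := by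
    obtain ⟨n, hn'⟩ : ∃ n, k * m = n + 1 := ⟨k * m - 1, by omega⟩
    rw [hn']
    have h1 := hind n (by omega)
    have h2 := hstep n (by omega)
    calc (1 + κ) ^ (n + 1) * L (n + 1) = (1 + κ) ^ n * ((1 + κ) * L (n + 1)) := by ring
      _ < (1 + κ) ^ n * L n := by gcongr
      _ ≤ L 0 := h1
  have hl2 : 0 < Real.log 2 := Real.log_pos (by norm_num)
  have : 2 ^ m * Real.log 2 ≤ (1 + κ) ^ (k * m) * L (k * m) :=
    mul_le_mul hpow hLn hl2.le (by positivity)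
  linarith

lemma rpow_split {a κ : ℝ} (ha : 0 < a) : a ^ (1 + κ) = a * a ^ κ := by
  rw [Real.rpow_add ha, Real.rpow_one]

lemma cut {k m : ℕ} (hk : 1 ≤ k) (hm : 1 ≤ m) {a : ℝ} {g : ℕ → ℝ} (hg : Monotone g)
    (h0 : 1 ≤ g 0) (hn : g (2 * (k * m)) ≤ a - 1) (ha : Real.log a ≤ 2 ^ m * Real.log 2) :
    ∃ i < 2 * (k * m), g (i + 1) ^ (1 + 1 / (k : ℝ)) + (a - g i) ^ (1 + 1 / (k : ℝ))
      ≤ a ^ (1 + 1 / (k : ℝ)) := by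
  have hg1 : ∀ i, 1 ≤ g i := fun i => h0.trans (hg (Nat.zero_le i))
  have ha0 : 0 < a := by linarith [hg1 (2 * (k * m))]
  have hκ : (0 : ℝ) ≤ 1 / (k : ℝ) := by positivity
  have hga : ∀ i ≤ 2 * (k * m), g i ≤ a - 1 := fun i hi => (hg hi).trans hn
  rcases le_total (g (k * m)) (a / 2) with h | h
  · obtain ⟨i, hi, h2⟩ := cut_half hk hm hg h0 h ha
    refine ⟨i, by omega, ?_⟩
    have h3 := hga i (by omega)
    have h4 : (a - g i) ^ (1 / (k : ℝ)) ≤ a ^ (1 / (k : ℝ)) :=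
      Real.rpow_le_rpow (by linarith) (by linarith [hg1 i]) hκ
    rw [rpow_split (a := a - g i) (by linarith), rpow_split ha0]
    have h5 : (a - g i) * (a - g i) ^ (1 / (k : ℝ)) ≤ (a - g i) * a ^ (1 / (k : ℝ)) :=
      mul_le_mul_of_nonneg_left h4 (by linarith)
    linarith
  · set g' : ℕ → ℝ := fun j => a - g (2 * (k * m) - j) with hg'
    have hm' : Monotone g' := by
      intro i j hij
      simp only [hg']
      have := hg (show 2 * (k * m) - j ≤ 2 * (k * m) - i by omega)
      linarith
    obtain ⟨j, hj, h2⟩ := cut_half (g := g') (a := a) hk hm hm' (by simp only [hg']; simp; linarith)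
      (by
        simp only [hg']
        rw [show 2 * (k * m) - k * m = k * m by omega]
        linarith) ha
    refine ⟨2 * (k * m) - (j + 1), by omega, ?_⟩
    simp only [hg'] at h2
    rw [show 2 * (k * m) - (j + 1) + 1 = 2 * (k * m) - j by omega]
    have h1 := hg1 (2 * (k * m) - j)
    have h3 := hga (2 * (k * m) - j) (by omega)
    have h4 : (g (2 * (k * m) - j)) ^ (1 / (k : ℝ)) ≤ a ^ (1 / (k : ℝ)) :=
      Real.rpow_le_rpow (by linarith) (by linarith) hκ
    rw [rpow_split (a := g (2 * (k * m) - j)) (by linarith), rpow_split ha0]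
    have h5 := mul_le_mul_of_nonneg_left h4 (show 0 ≤ g (2 * (k * m) - j) by linarith)
    linarith

end Cut

/-- A rooted tree with a projection to `V`, satisfying all conclusions needed in the recursion. -/
structure Emb {V : Type} (G : SimpleGraph V) (w₀ : Sym2 V → ℝ) (μ : V → ℝ) (κ K : ℝ)
    (S : Finset V) (w : Sym2 V → ℝ) (x₀ : V) (P : Finset V) : Type 1 where
  Y : Type
  fin : Fintype Y
  T : SimpleGraph Y
  π : Y → V
  root : Y
  χ : V → Y
  tree : T.IsTree
  mem : ∀ a, π a ∈ S
  adj : ∀ a b, T.Adj a b → G.Adj (π a) (π b)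
  hroot : π root = x₀
  hχ : ∀ v ∈ S, π (χ v) = v
  rad : ∀ a, spDist T (fun e => w₀ (e.map π)) root a ≤ 4 * spDist (rg G S) w x₀ (π a)
  hwy : ∀ p ∈ P, ∃ a, π a = p ∧
    spDist T (fun e => w₀ (e.map π)) root a ≤ 2 * spDist (rg G S) w x₀ p
  dist : ∀ u ∈ S, ∀ v ∈ S, ∃ a, π a = v ∧
    spDist T (fun e => w₀ (e.map π)) (χ u) a ≤ K * spDist (rg G S) w u v
  cost : ∑ a, μ (π a) ≤ (∑ v ∈ S, μ v) ^ (1 + κ)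

section GlueEmb

variable {V : Type} [Finite V] {G : SimpleGraph V} {w₀ : Sym2 V → ℝ} {μ : V → ℝ} {κ K : ℝ}

lemma glue_emb {S A B P P₁ P₂ : Finset V} {w w' : Sym2 V → ℝ} {x₀ x₁ y : V} {Δ δ h : ℝ}
    (hw₀ : ∀ e, 0 < w₀ e) (hw : ∀ e, 0 < w e)
    (E₁ : Emb G w₀ μ κ K B w x₀ P₂) (E₂ : Emb G w₀ μ κ K A w' x₁ P₁)
    (hA : A ⊆ S) (hB : B ⊆ S)
    (hΔ : ∀ z ∈ S, spDist (rg G S) w x₀ z ≤ Δ)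
    (hpad : ∀ u ∈ S,
      (u ∈ A ∧ ∀ v ∈ S, spDist (rg G S) w u v ≤ δ →
        v ∈ A ∧ spDist (rg G A) w' u v ≤ spDist (rg G S) w u v) ∨
      (u ∈ B ∧ ∀ v ∈ S, spDist (rg G S) w u v ≤ δ →
        v ∈ B ∧ spDist (rg G B) w u v ≤ spDist (rg G S) w u v))
    (hBd : ∀ z ∈ B, spDist (rg G B) w x₀ z ≤ spDist (rg G S) w x₀ z)
    (hadj : G.Adj y x₁)
    (y' : E₁.Y) (hy' : E₁.π y' = y)
    (hh : spDist E₁.T (fun e => w₀ (e.map E₁.π)) E₁.root y' ≤ h)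
    (hAd : ∀ z ∈ A, h + w₀ s(y, x₁) + 4 * spDist (rg G A) w' x₁ z ≤ 4 * spDist (rg G S) w x₀ z)
    (hP : ∀ p ∈ P, (p ∈ P₂ ∧ p ∈ B) ∨
      (p ∈ P₁ ∧ h + w₀ s(y, x₁) + 2 * spDist (rg G A) w' x₁ p ≤ 2 * spDist (rg G S) w x₀ p))
    (hK0 : 0 ≤ K) (hK : 8 * Δ ≤ K * δ)
    (hcost : (∑ v ∈ A, μ v) ^ (1 + κ) + (∑ v ∈ B, μ v) ^ (1 + κ) ≤ (∑ v ∈ S, μ v) ^ (1 + κ)) :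
    Nonempty (Emb G w₀ μ κ K S w x₀ P) := by
  classical
  obtain ⟨Y₁, fin₁, T₁, π₁, r₁, χ₁, tree₁, mem₁, adj₁, hroot₁, hχ₁, rad₁, hwy₁, dist₁, cost₁⟩ := E₁
  obtain ⟨Y₂, fin₂, T₂, π₂, r₂, χ₂, tree₂, mem₂, adj₂, hroot₂, hχ₂, rad₂, hwy₂, dist₂, cost₂⟩ := E₂
  simp only at y' hy' hh
  subst hy'
  set T := glueT T₁ T₂ y' r₂ with hT
  set π : Y₁ ⊕ Y₂ → V := Sum.elim π₁ π₂ with hπ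
  set W : Sym2 (Y₁ ⊕ Y₂) → ℝ := fun e => w₀ (e.map π) with hW
  have hW0 : ∀ e, 0 ≤ W e := fun e => (hw₀ _).le
  have h10 : ∀ e : Sym2 Y₁, 0 ≤ w₀ (e.map π₁) := fun e => (hw₀ _).le
  have h20 : ∀ e : Sym2 Y₂, 0 ≤ w₀ (e.map π₂) := fun e => (hw₀ _).le
  have hTtree : T.IsTree := glueT_isTree tree₁ tree₂
  have hTc := hTtree.connected
  have hl : ∀ a b, spDist T W (Sum.inl a) (Sum.inl b) ≤ spDist T₁ (fun e => w₀ (e.map π₁)) a b := by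
    intro a b
    exact spd_map h10 hW0 (glL T₁ T₂ y' r₂) (by intro a b _; simp [hW, glL, hπ])
      (tree₁.connected a b)
  have hr : ∀ a b, spDist T W (Sum.inr a) (Sum.inr b) ≤ spDist T₂ (fun e => w₀ (e.map π₂)) a b := by
    intro a b
    exact spd_map h20 hW0 (glR T₁ T₂ y' r₂) (by intro a b _; simp [hW, glR, hπ])
      (tree₂.connected a b)
  have hmid : spDist T W (Sum.inl y') (Sum.inr r₂) ≤ w₀ s(π₁ y', x₁) := by
    refine (spd_adj hW0 (glueT_lr.2 ⟨rfl, rfl⟩)).trans ?_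
    simp [hW, hπ, hroot₂]
  have hroot2 : ∀ b, spDist T W (Sum.inl r₁) (Sum.inr b) ≤
      h + w₀ s(π₁ y', x₁) + spDist T₂ (fun e => w₀ (e.map π₂)) r₂ b := by
    intro b
    have h1 := spd_triangle hW0 (hTc (Sum.inl r₁) (Sum.inl y')) (hTc (Sum.inl y') (Sum.inr b))
    have h2 := spd_triangle hW0 (hTc (Sum.inl y') (Sum.inr r₂)) (hTc (Sum.inr r₂) (Sum.inr b))
    have h3 := hl r₁ y'
    have h4 := hr r₂ b
    linarith
  have hmem : ∀ a, π a ∈ S := by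
    rintro (a | a)
    · exact hB (mem₁ a)
    · exact hA (mem₂ a)
  have hrad : ∀ a, spDist T W (Sum.inl r₁) a ≤ 4 * spDist (rg G S) w x₀ (π a) := by
    rintro (a | a)
    · have h1 := hl r₁ a
      have h2 := rad₁ a
      have h3 := hBd _ (mem₁ a)
      simp only [hπ, Sum.elim_inl]
      linarith
    · have h1 := hroot2 a
      have h2 := rad₂ a
      have h3 := hAd _ (mem₂ a)
      simp only [hπ, Sum.elim_inr]
      linarith
  set pA : V → Prop := fun u => u ∈ A ∧ ∀ v ∈ S, spDist (rg G S) w u v ≤ δ →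
        v ∈ A ∧ spDist (rg G A) w' u v ≤ spDist (rg G S) w u v with hpA
  set χ : V → Y₁ ⊕ Y₂ := fun u => if pA u then Sum.inr (χ₂ u) else Sum.inl (χ₁ u) with hχdef
  have hBof : ∀ u ∈ S, ¬ pA u → (u ∈ B ∧ ∀ v ∈ S, spDist (rg G S) w u v ≤ δ →
        v ∈ B ∧ spDist (rg G B) w u v ≤ spDist (rg G S) w u v) := by
    intro u hu hn
    exact (hpad u hu).resolve_left hn
  have hχ : ∀ v ∈ S, π (χ v) = v := by
    intro v hv
    by_cases hc : pA v
    · simp only [hχdef, if_pos hc, hπ, Sum.elim_inr]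
      exact hχ₂ v hc.1
    · simp only [hχdef, if_neg hc, hπ, Sum.elim_inl]
      exact hχ₁ v (hBof v hv hc).1
  refine ⟨⟨Y₁ ⊕ Y₂, inferInstance, T, π, Sum.inl r₁, χ, hTtree, hmem, ?_, by simp [hπ, hroot₁],
    hχ, hrad, ?_, ?_, ?_⟩⟩
  · rintro (a | a) (b | b) hab
    · exact adj₁ a b (glueT_inl.1 hab)
    · obtain ⟨rfl, rfl⟩ := glueT_lr.1 hab
      simp only [hπ, Sum.elim_inl, Sum.elim_inr, hroot₂]
      exact hadj
    · obtain ⟨rfl, rfl⟩ := glueT_lr.1 hab.symm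
      simp only [hπ, Sum.elim_inl, Sum.elim_inr, hroot₂]
      exact hadj.symm
    · exact adj₂ a b (glueT_inr.1 hab)
  · intro p hp
    rcases hP p hp with ⟨hp2, hpB⟩ | ⟨hp1, hle⟩
    · obtain ⟨a, ha, had⟩ := hwy₁ p hp2
      refine ⟨Sum.inl a, by simpa [hπ] using ha, ?_⟩
      have h1 := hl r₁ a
      have h3 := hBd _ hpB
      linarith
    · obtain ⟨a, ha, had⟩ := hwy₂ p hp1
      refine ⟨Sum.inr a, by simpa [hπ] using ha, ?_⟩
      have h1 := hroot2 a
      linarith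
  · intro u hu v hv
    by_cases hd : spDist (rg G S) w u v ≤ δ
    · by_cases hc : pA u
      · obtain ⟨hvA, hdd⟩ := hc.2 v hv hd
        obtain ⟨a, ha, had⟩ := dist₂ u hc.1 v hvA
        refine ⟨Sum.inr a, by simpa [hπ] using ha, ?_⟩
        simp only [hχdef, if_pos hc]
        refine (hr _ _).trans (had.trans ?_)
        exact mul_le_mul_of_nonneg_left hdd hK0
      · obtain ⟨huB, hb⟩ := hBof u hu hc
        obtain ⟨hvB, hdd⟩ := hb v hv hd
        obtain ⟨a, ha, had⟩ := dist₁ u huB v hvB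
        refine ⟨Sum.inl a, by simpa [hπ] using ha, ?_⟩
        simp only [hχdef, if_neg hc]
        refine (hl _ _).trans (had.trans ?_)
        exact mul_le_mul_of_nonneg_left hdd hK0
    · refine ⟨χ v, hχ v hv, ?_⟩
      have h1 := spd_triangle hW0 (hTc (χ u) (Sum.inl r₁)) (hTc (Sum.inl r₁) (χ v))
      rw [spd_symm (χ u) (Sum.inl r₁)] at h1
      have h2 := hrad (χ u)
      have h3 := hrad (χ v)
      rw [hχ u hu] at h2
      rw [hχ v hv] at h3
      have h4 := hΔ u hu
      have h5 := hΔ v hv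
      have h6 := mul_le_mul_of_nonneg_left (not_le.1 hd).le hK0
      linarith
  · rw [Fintype.sum_sum_type]
    simp only [hπ, Sum.elim_inl, Sum.elim_inr]
    linarith

end GlueEmb

section Hwy

variable {V : Type} [Finite V] {G : SimpleGraph V} {w : Sym2 V → ℝ}

/-- `P` is the vertex set of a shortest path from `x₀` to `t` inside `S`. -/
structure IsHwy (G : SimpleGraph V) (S : Finset V) (w : Sym2 V → ℝ) (x₀ t : V) (P : Finset V) :
    Prop where
  sub : P ⊆ S
  hx : x₀ ∈ P
  ht : t ∈ P
  top : ∀ p ∈ P, spDist (rg G S) w x₀ p ≤ spDist (rg G S) w x₀ t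
  inj : ∀ p ∈ P, ∀ q ∈ P, spDist (rg G S) w x₀ p = spDist (rg G S) w x₀ q → p = q
  chain : ∀ p ∈ P, p ≠ x₀ → ∃ q ∈ P, G.Adj q p ∧
    spDist (rg G S) w x₀ q + w s(q, p) ≤ spDist (rg G S) w x₀ p ∧
    ∀ s ∈ P, spDist (rg G S) w x₀ s < spDist (rg G S) w x₀ p →
      spDist (rg G S) w x₀ s ≤ spDist (rg G S) w x₀ q

lemma hwy_single {S : Finset V} {x₀ : V} (hx : x₀ ∈ S) : IsHwy G S w x₀ x₀ {x₀} where
  sub := by simpa using hx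
  hx := by simp
  ht := by simp
  top := by simp
  inj := by simp
  chain := by simp

lemma exists_hwy_aux (hw : ∀ e, 0 < w e) {S : Finset V} (hS : Conn G S) {z x₀ : V}
    (q : (rg G S).Walk z x₀) (hx : x₀ ∈ S) (hz : z ∈ S) (hq : wt w q = spDist (rg G S) w x₀ z) :
    ∃ P, IsHwy G S w x₀ z P := by
  classical
  have hw' : ∀ e, 0 ≤ w e := fun e => (hw e).le
  induction q with
  | nil => exact ⟨_, hwy_single hx⟩
  | @cons z y x₀ h q ih =>
    have hy : y ∈ S := h.2.2
    have h1 : spDist (rg G S) w x₀ y ≤ wt w q := by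
      rw [spd_symm]; exact spd_le hw' q
    have h2 := spd_triangle hw' (hS x₀ hx y hy) (hS y hy z hz)
    have h3 := spd_adj hw' h.symm
    rw [Sym2.eq_swap] at h3
    rw [wt_cons] at hq
    obtain ⟨P, hP⟩ := ih hx hy (by linarith)
    have hzy : spDist (rg G S) w x₀ y + w s(z, y) = spDist (rg G S) w x₀ z := by linarith
    have hpos := hw s(z, y)
    have hlt : ∀ p ∈ P, spDist (rg G S) w x₀ p < spDist (rg G S) w x₀ z := by
      intro p hp
      linarith [hP.top p hp]
    refine ⟨insert z P, ?_, ?_, ?_, ?_, ?_, ?_⟩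
    · exact Finset.insert_subset hz hP.sub
    · exact Finset.mem_insert_of_mem hP.hx
    · exact Finset.mem_insert_self _ _
    · intro p hp
      rcases Finset.mem_insert.1 hp with rfl | hp
      · exact le_rfl
      · exact (hlt p hp).le
    · intro p hp r hr hpr
      rcases Finset.mem_insert.1 hp with rfl | hp' <;> rcases Finset.mem_insert.1 hr with rfl | hr'
      · rfl
      · exact absurd hpr (hlt r hr').ne'
      · exact absurd hpr (hlt p hp').ne
      · exact hP.inj p hp' r hr' hpr
    · intro p hp hpx
      rcases Finset.mem_insert.1 hp with rfl | hp'
      · refine ⟨y, Finset.mem_insert_of_mem hP.ht, h.1.symm, ?_, ?_⟩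
        · rw [Sym2.eq_swap]; exact hzy.le
        · intro s hs hsp
          rcases Finset.mem_insert.1 hs with rfl | hs
          · exact absurd hsp (lt_irrefl _)
          · exact hP.top s hs
      · obtain ⟨r, hr, hadj, hd, hmax⟩ := hP.chain p hp' hpx
        refine ⟨r, Finset.mem_insert_of_mem hr, hadj, hd, ?_⟩
        intro s hs hsp
        rcases Finset.mem_insert.1 hs with rfl | hs
        · exact absurd hsp (hlt p hp').le.not_gt
        · exact hmax s hs hsp

lemma exists_hwy (hw : ∀ e, 0 < w e) {S : Finset V} (hS : Conn G S) {z x₀ : V}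
    (hx : x₀ ∈ S) (hz : z ∈ S) : ∃ P, IsHwy G S w x₀ z P := by
  obtain ⟨q, hq⟩ := spd_exists (w := w) (fun e => (hw e).le) (hS z hz x₀ hx)
  exact exists_hwy_aux hw hS q hx hz (by rw [hq, spd_symm])

lemma chain_induct {H : SimpleGraph V} {w' : Sym2 V → ℝ} (hw' : ∀ e, 0 ≤ w' e) {c : ℝ}
    (f : V → ℝ) (P : Finset V) (x₁ : V)
    (inj : ∀ p ∈ P, ∀ q ∈ P, f p = f q → p = q) (hmin : ∀ p ∈ P, f x₁ ≤ f p)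
    (chain : ∀ p ∈ P, p ≠ x₁ → ∃ q ∈ P, f q < f p ∧ H.Adj q p ∧ w' s(q, p) ≤ c * (f p - f q) ∧
      ∀ s ∈ P, f s < f p → f s ≤ f q) :
    ∀ n : ℕ, ∀ q ∈ P, (P.filter (fun s => f s < f q)).card ≤ n → ∀ p ∈ P, f p ≤ f q →
      H.Reachable p q ∧ spDist H w' p q ≤ c * (f q - f p) := by
  intro n
  induction n with
  | zero =>
    intro q hq hc p hp hpq
    have : p = q := by
      apply inj p hp q hq
      refine le_antisymm hpq (not_lt.1 fun hlt => ?_)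
      have : p ∈ P.filter (fun s => f s < f q) := Finset.mem_filter.2 ⟨hp, hlt⟩
      rw [Finset.card_eq_zero.1 (Nat.le_zero.1 hc)] at this
      simp at this
    subst this
    exact ⟨Reachable.refl _, by rw [spd_self hw']; simp⟩
  | succ n ih =>
    intro q hq hc p hp hpq
    rcases hpq.eq_or_lt with he | hlt
    · have := inj p hp q hq he
      subst this
      exact ⟨Reachable.refl _, by rw [spd_self hw']; simp⟩
    · have hqx : q ≠ x₁ := by
        rintro rfl
        exact absurd (hmin p hp) (not_le.2 hlt)
      obtain ⟨r, hr, hrq, hadj, hwr, hmax⟩ := chain q hq hqx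
      have hcard : (P.filter (fun s => f s < f r)).card ≤ n := by
        have : (P.filter (fun s => f s < f r)).card < (P.filter (fun s => f s < f q)).card := by
          apply Finset.card_lt_card
          rw [Finset.ssubset_iff_of_subset]
          · exact ⟨r, Finset.mem_filter.2 ⟨hr, hrq⟩, by simp⟩
          · intro s hs
            rw [Finset.mem_filter] at hs ⊢
            exact ⟨hs.1, hs.2.trans hrq⟩
        omega
      obtain ⟨h1, h2⟩ := ih r hr hcard p hp (hmax p hp hlt)
      refine ⟨h1.trans hadj.reachable, ?_⟩
      have h3 := spd_triangle hw' h1 hadj.reachable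
      have h4 := spd_adj hw' hadj
      linarith

/-- Highways restrict to sets that are closed towards the root. -/
lemma hwy_rest (hw : ∀ e, 0 < w e) {S B P : Finset V} {x₀ t : V} (hBS : B ⊆ S)
    (hx : x₀ ∈ B) (hS : Conn G S)
    (hup : ∀ s ∈ S, ∀ z ∈ B, spDist (rg G S) w x₀ s + spDist (rg G S) w s z
      ≤ spDist (rg G S) w x₀ z → s ∈ B) (hP : IsHwy G S w x₀ t P)
    (hd : ∀ z ∈ B, spDist (rg G B) w x₀ z = spDist (rg G S) w x₀ z) (P₂ : Finset V)
    (hP₂ : ∀ z, z ∈ P₂ ↔ z ∈ P ∧ z ∈ B) :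
    ∃ t₀, IsHwy G B w x₀ t₀ P₂ := by
  have hw' : ∀ e, 0 ≤ w e := fun e => (hw e).le
  have hx2 : x₀ ∈ P₂ := (hP₂ _).2 ⟨hP.hx, hx⟩
  have hsub : P₂ ⊆ B := fun z hz => ((hP₂ z).1 hz).2
  have hsubP : P₂ ⊆ P := fun z hz => ((hP₂ z).1 hz).1
  obtain ⟨t₀, ht₀, hmax⟩ := Finset.exists_max_image P₂ (fun z => spDist (rg G B) w x₀ z) ⟨x₀, hx2⟩
  refine ⟨t₀, hsub, hx2, ht₀, hmax, ?_, ?_⟩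
  · intro p hp q hq h
    rw [hd p (hsub hp), hd q (hsub hq)] at h
    exact hP.inj p (hsubP hp) q (hsubP hq) h
  · intro p hp hpx
    obtain ⟨q, hq, hadj, hle, hm⟩ := hP.chain p (hsubP hp) hpx
    have hqS := hP.sub hq
    have hpS := hP.sub (hsubP hp)
    have hqB : q ∈ B := by
      apply hup q hqS p (hsub hp)
      have := spd_adj (H := rg G S) hw' (u := q) (v := p) ⟨hadj, hqS, hpS⟩
      linarith
    refine ⟨q, (hP₂ q).2 ⟨hq, hqB⟩, hadj, ?_, ?_⟩
    · rw [hd q hqB, hd p (hsub hp)]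
      exact hle
    · intro s hs hsp
      rw [hd s (hsub hs), hd p (hsub hp)] at hsp
      rw [hd s (hsub hs), hd q hqB]
      exact hm s (hsubP hs) hsp

end Hwy

section Petal

variable {V : Type} [Finite V] {G : SimpleGraph V}

lemma exists_phi (D : V → ℝ) (d : V → V → ℝ) {Q : Finset V} (hQ : Q.Nonempty) (T : ℝ) :
    ∃ φ : V → ℝ, (∀ z, ∀ p ∈ Q, φ z ≤ T - 2 * D z + D p + 2 * d p z) ∧
      ∀ z, ∃ p ∈ Q, φ z = T - 2 * D z + D p + 2 * d p z := by
  have h := fun z => Finset.exists_min_image Q (fun p => T - 2 * D z + D p + 2 * d p z) hQ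
  choose m hm hmin using h
  exact ⟨fun z => T - 2 * D z + D (m z) + 2 * d (m z) z, fun z p hp => hmin z p hp,
    fun z => ⟨m z, hm z, rfl⟩⟩

/-- All geometric properties of the petal `A` and the remaining part `B`. -/
structure Petal (G : SimpleGraph V) (w w' : Sym2 V → ℝ) (c δ : ℝ) (S Q A B : Finset V)
    (x₀ τ x₁ y : V) (R : ℝ) : Prop where
  hAS : A ⊆ S
  hBS : B ⊆ S
  hτ : τ ∉ B
  hx : x₀ ∈ B
  hx1 : x₁ ∈ A
  cA : Conn G A
  cB : Conn G B
  pad : ∀ u ∈ S,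
      (u ∈ A ∧ ∀ v ∈ S, spDist (rg G S) w u v ≤ δ →
        v ∈ A ∧ spDist (rg G A) w' u v ≤ spDist (rg G S) w u v) ∨
      (u ∈ B ∧ ∀ v ∈ S, spDist (rg G S) w u v ≤ δ →
        v ∈ B ∧ spDist (rg G B) w u v ≤ spDist (rg G S) w u v)
  dB : ∀ z ∈ B, spDist (rg G B) w x₀ z = spDist (rg G S) w x₀ z
  up : ∀ s ∈ S, ∀ z ∈ B, spDist (rg G S) w x₀ s + spDist (rg G S) w s z
      ≤ spDist (rg G S) w x₀ z → s ∈ B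
  yQ : y ∈ Q
  yB : y ∈ B
  x1Q : x₁ ∈ Q
  adj : G.Adj y x₁
  hy : spDist (rg G S) w x₀ y + w s(y, x₁) ≤ spDist (rg G S) w x₀ x₁
  hyR : spDist (rg G S) w x₀ y < spDist (rg G S) w x₀ τ - R
  out : ∀ z ∈ A, spDist (rg G S) w x₀ τ - R ≤ spDist (rg G S) w x₀ z
  cov : ∀ z ∈ S, z ∉ A → z ∈ B
  hwy : ∀ P₁ : Finset V, (∀ z, z ∈ P₁ ↔ z ∈ Q ∧ z ∈ A) → IsHwy G A w' x₁ τ P₁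
  hwyd : ∀ q ∈ Q, q ∈ A → spDist (rg G A) w' x₁ q ≤
    c * (spDist (rg G S) w x₀ q - spDist (rg G S) w x₀ x₁)
  rad : ∀ z ∈ A, ∃ p ∈ Q, spDist (rg G S) w x₀ x₁ ≤ spDist (rg G S) w x₀ p ∧
    spDist (rg G S) w x₀ p ≤ spDist (rg G S) w x₀ τ ∧
    spDist (rg G A) w' x₁ z ≤ c * (spDist (rg G S) w x₀ p - spDist (rg G S) w x₀ x₁) +
      (R + 2 * spDist (rg G S) w x₀ z - spDist (rg G S) w x₀ τ - spDist (rg G S) w x₀ p) / 2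

lemma petal_geom {w w' : Sym2 V → ℝ} {c δ : ℝ} {S Q A B : Finset V} {x₀ τ : V} {r R : ℝ}
    (hw : ∀ e, 0 < w e) (hw' : ∀ e, 0 < w' e) (hle : ∀ e, w' e ≤ w e) (hc0 : 0 < c)
    (hcw : ∀ e, c * w e ≤ w' e) (hS : Conn G S)
    (hQ : IsHwy G S w x₀ τ Q) (hQw : ∀ u ∈ Q, ∀ v ∈ Q, w' s(u, v) ≤ c * w s(u, v))
    (hr : 0 ≤ r) (hrR : r + 8 * δ ≤ R) (hδ : 0 < δ) (hR : R < spDist (rg G S) w x₀ τ)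
    (φ : V → ℝ) (h1 : ∀ z, ∀ p ∈ Q, φ z ≤ spDist (rg G S) w x₀ τ - 2 * spDist (rg G S) w x₀ z
      + spDist (rg G S) w x₀ p + 2 * spDist (rg G S) w p z)
    (h2 : ∀ z, ∃ p ∈ Q, φ z = spDist (rg G S) w x₀ τ - 2 * spDist (rg G S) w x₀ z
      + spDist (rg G S) w x₀ p + 2 * spDist (rg G S) w p z)
    (hA : ∀ z, z ∈ A ↔ z ∈ S ∧ φ z ≤ R) (hB : ∀ z, z ∈ B ↔ z ∈ S ∧ r < φ z) :
    ∃ x₁ y, Petal G w w' c δ S Q A B x₀ τ x₁ y R := by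
  classical
  have w0 : ∀ e, 0 ≤ w e := fun e => (hw e).le
  have w0' : ∀ e, 0 ≤ w' e := fun e => (hw' e).le
  have hAS : A ⊆ S := fun z hz => ((hA z).1 hz).1
  have hBS : B ⊆ S := fun z hz => ((hB z).1 hz).1
  have hx0S : x₀ ∈ S := hQ.sub hQ.hx
  have hτS : τ ∈ S := hQ.sub hQ.ht
  set d := spDist (rg G S) w with hd
  have tri : ∀ a ∈ S, ∀ b ∈ S, ∀ e ∈ S, d a e ≤ d a b + d b e := fun a ha b hb e he =>
    spd_triangle w0 (hS a ha b hb) (hS b hb e he)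
  have sym : ∀ a b, d a b = d b a := fun a b => spd_symm a b
  have nn : ∀ a b, 0 ≤ d a b := fun a b => spd_nonneg w0 a b
  have self : ∀ a, d a a = 0 := fun a => spd_self w0 a
  have eδ : ∀ a b, G.Adj a b → a ∈ S → b ∈ S → d a b ≤ w s(a, b) := fun a b h ha hb =>
    spd_adj (H := rg G S) w0 ⟨h, ha, hb⟩
  have pc : ∀ z ∈ S, d x₀ τ - d x₀ z ≤ φ z := by
    intro z hz
    obtain ⟨p, hp, he⟩ := h2 z
    have := tri x₀ hx0S p (hQ.sub hp) z hz
    have := nn p z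
    linarith
  have pd : ∀ q ∈ Q, φ q ≤ d x₀ τ - d x₀ q := by
    intro q hq
    have := h1 q q hq
    rw [self] at this
    linarith
  have pe : ∀ u ∈ S, ∀ v ∈ S, φ v ≤ φ u + 4 * d u v := by
    intro u hu v hv
    obtain ⟨p, hp, he⟩ := h2 u
    have a1 := h1 v p hp
    have a2 := tri p (hQ.sub hp) u hu v hv
    have a3 := tri x₀ hx0S v hv u hu
    rw [sym v u] at a3
    linarith
  have pf : ∀ s ∈ S, ∀ z ∈ S, d x₀ s + d s z ≤ d x₀ z → φ z ≤ φ s := by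
    intro s hs z hz h
    obtain ⟨p, hp, he⟩ := h2 s
    have a1 := h1 z p hp
    have a2 := tri p (hQ.sub hp) s hs z hz
    linarith
  have hx0B : x₀ ∈ B := by
    refine (hB _).2 ⟨hx0S, ?_⟩
    have := pc x₀ hx0S
    rw [self] at this
    linarith
  have hx0A : x₀ ∉ A := by
    intro h
    have := pc x₀ hx0S
    rw [self] at this
    linarith [((hA _).1 h).2]
  have pτ : φ τ ≤ 0 := by
    have := pd τ hQ.ht
    linarith
  have hτA : τ ∈ A := (hA _).2 ⟨hτS, by linarith⟩
  have up : ∀ s ∈ S, ∀ z ∈ B, d x₀ s + d s z ≤ d x₀ z → s ∈ B := by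
    intro s hs z hz h
    have := pf s hs z (hBS hz) h
    exact (hB s).2 ⟨hs, by linarith [((hB z).1 hz).2]⟩
  have stB : ∀ z ∈ B, (rg G B).Reachable x₀ z ∧ spDist (rg G B) w x₀ z ≤ d x₀ z := by
    intro z hz
    exact stay w0 hS hx0S (hBS hz) (fun s hs h => up s hs z hz h)
  obtain ⟨x₁, hx1, hmin⟩ := Finset.exists_min_image (Q.filter (· ∈ A)) (fun z => d x₀ z)
    ⟨τ, Finset.mem_filter.2 ⟨hQ.ht, hτA⟩⟩
  rw [Finset.mem_filter] at hx1
  obtain ⟨hx1Q, hx1A⟩ := hx1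
  have hmin' : ∀ q ∈ Q, q ∈ A → d x₀ x₁ ≤ d x₀ q := fun q hq hqA =>
    hmin q (Finset.mem_filter.2 ⟨hq, hqA⟩)
  have hx10 : x₁ ≠ x₀ := by rintro rfl; exact hx0A hx1A
  obtain ⟨y, hyQ, hyadj, hyle, hymax⟩ := hQ.chain x₁ hx1Q hx10
  have hyw := hw s(y, x₁)
  have hyA : y ∉ A := by
    intro h
    have := hmin' y hyQ h
    linarith
  have hyS := hQ.sub hyQ
  have hyφ : R < φ y := by
    by_contra h
    exact hyA ((hA y).2 ⟨hyS, not_lt.1 h⟩)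
  have hyR : d x₀ y < d x₀ τ - R := by linarith [pd y hyQ]
  have out : ∀ z ∈ A, d x₀ τ - R ≤ d x₀ z := by
    intro z hz
    linarith [pc z (hAS hz), ((hA z).1 hz).2]
  have QA : ∀ q ∈ Q, d x₀ x₁ ≤ d x₀ q → q ∈ A := by
    intro q hq h
    exact (hA q).2 ⟨hQ.sub hq, by linarith [pd q hq, out x₁ hx1A]⟩
  have hchain : ∀ p ∈ Q.filter (· ∈ A), p ≠ x₁ → ∃ q ∈ Q.filter (· ∈ A), d x₀ q < d x₀ p ∧
      (rg G A).Adj q p ∧ w' s(q, p) ≤ c * (d x₀ p - d x₀ q) ∧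
      ∀ s ∈ Q.filter (· ∈ A), d x₀ s < d x₀ p → d x₀ s ≤ d x₀ q := by
    intro p hp hpx
    obtain ⟨hpQ, hpA⟩ := Finset.mem_filter.1 hp
    have hp0 : p ≠ x₀ := by rintro rfl; exact hx0A hpA
    obtain ⟨q, hq, hadj, hqle, hmax⟩ := hQ.chain p hpQ hp0
    have hlt : d x₀ x₁ < d x₀ p :=
      lt_of_le_of_ne (hmin' p hpQ hpA) (fun h => hpx (hQ.inj x₁ hx1Q p hpQ h).symm)
    have hqA : q ∈ A := QA q hq (hmax x₁ hx1Q hlt)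
    refine ⟨q, Finset.mem_filter.2 ⟨hq, hqA⟩, ?_, ⟨hadj, hqA, hpA⟩, ?_, ?_⟩
    · linarith [hw s(q, p)]
    · refine (hQw q hq p hpQ).trans ?_
      apply mul_le_mul_of_nonneg_left _ hc0.le
      linarith
    · intro s hs h
      exact hmax s (Finset.mem_filter.1 hs).1 h
  have hci := fun q (hq : q ∈ Q.filter (· ∈ A)) =>
    chain_induct (H := rg G A) (c := c) w0' (fun z => d x₀ z) (Q.filter (· ∈ A)) x₁
      (fun p hp q hq h => hQ.inj p (Finset.mem_filter.1 hp).1 q (Finset.mem_filter.1 hq).1 h)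
      hmin hchain _ q hq le_rfl x₁ (Finset.mem_filter.2 ⟨hx1Q, hx1A⟩) (hmin q hq)
  have hD : ∀ q ∈ Q, q ∈ A → spDist (rg G A) w' x₁ q = c * (d x₀ q - d x₀ x₁) := by
    intro q hq hqA
    obtain ⟨a1, a2⟩ := hci q (Finset.mem_filter.2 ⟨hq, hqA⟩)
    refine le_antisymm a2 ?_
    have := spd_potential (H := rg G A) w0' (fun z => c * d x₀ z) (by
      intro a b hab
      refine le_trans ?_ (hcw s(a, b))
      have b1 := tri x₀ hx0S a (hAS hab.2.1) b (hAS hab.2.2)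
      have b2 := eδ a b hab.1 (hAS hab.2.1) (hAS hab.2.2)
      have : c * (d x₀ b - d x₀ a) ≤ c * w s(a, b) :=
        mul_le_mul_of_nonneg_left (by linarith) hc0.le
      linarith) a1
    linarith
  have hradA : ∀ z ∈ A, ∃ p ∈ Q, d x₀ x₁ ≤ d x₀ p ∧ d x₀ p ≤ d x₀ τ ∧ (rg G A).Reachable x₁ z ∧
      spDist (rg G A) w' x₁ z ≤ c * (d x₀ p - d x₀ x₁) +
      (R + 2 * d x₀ z - d x₀ τ - d x₀ p) / 2 := by
    intro z hz
    obtain ⟨hzS, hzR⟩ := (hA z).1 hz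
    obtain ⟨p, hp, he⟩ := h2 z
    have hpS := hQ.sub hp
    have t1 := tri x₀ hx0S p hpS z hzS
    have hpA : p ∈ A := (hA p).2 ⟨hpS, by linarith [pd p hp]⟩
    have hst := stay (A := A) w0 hS hpS hzS (by
      intro s hs h
      refine (hA s).2 ⟨hs, ?_⟩
      have a1 := h1 s p hp
      have a2 := tri x₀ hx0S s hs z hzS
      rw [← hd] at h
      linarith)
    obtain ⟨r1, e1⟩ := hci p (Finset.mem_filter.2 ⟨hp, hpA⟩)
    refine ⟨p, hp, hmin' p hp hpA, hQ.top p hp, r1.trans hst.1, ?_⟩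
    have a3 := spd_triangle w0' r1 hst.1
    have a4 := spd_mono (H := rg G A) (H' := rg G A) w0 w0' le_rfl (fun a b _ => hle s(a, b)) hst.1
    have a5 := hst.2
    rw [← hd] at a5
    linarith
  refine ⟨x₁, y, ?_⟩
  constructor
  · exact hAS
  · exact hBS
  · intro h
    linarith [((hB τ).1 h).2]
  · exact hx0B
  · exact hx1A
  · intro u hu v hv
    obtain ⟨_, _, _, _, a, _⟩ := hradA u hu
    obtain ⟨_, _, _, _, b, _⟩ := hradA v hv
    exact a.symm.trans b
  · intro u hu v hv
    exact (stB u hu).1.symm.trans (stB v hv).1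
  · intro u hu
    rcases le_or_gt (φ u) (r + 4 * δ) with h | h
    · left
      refine ⟨(hA u).2 ⟨hu, by linarith⟩, ?_⟩
      intro v hv hvd
      rw [← hd] at hvd ⊢
      have key : ∀ s ∈ S, d u s ≤ δ → s ∈ A := by
        intro s hs h
        exact (hA s).2 ⟨hs, by linarith [pe u hu s hs]⟩
      have hst := stay (A := A) w0 hS hu hv (by
        intro s hs h
        rw [← hd] at h
        exact key s hs (by linarith [nn s v]))
      have a4 := spd_mono (H := rg G A) (H' := rg G A) w0 w0' le_rfl
        (fun a b _ => hle s(a, b)) hst.1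
      exact ⟨key v hv hvd, a4.trans hst.2⟩
    · right
      refine ⟨(hB u).2 ⟨hu, by linarith⟩, ?_⟩
      intro v hv hvd
      rw [← hd] at hvd ⊢
      have key : ∀ s ∈ S, d u s ≤ δ → s ∈ B := by
        intro s hs h
        have := pe s hs u hu
        rw [sym s u] at this
        exact (hB s).2 ⟨hs, by linarith⟩
      have hst := stay (A := B) w0 hS hu hv (by
        intro s hs h
        rw [← hd] at h
        exact key s hs (by linarith [nn s v]))
      exact ⟨key v hv hvd, hst.2⟩
  · intro z hz
    refine le_antisymm (stB z hz).2 ?_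
    exact spd_mono w0 w0 (rg_mono hBS) (fun _ _ _ => le_rfl) (stB z hz).1
  · exact up
  · exact hyQ
  · exact (hB y).2 ⟨hyS, by linarith⟩
  · exact hx1Q
  · exact hyadj
  · exact hyle
  · exact hyR
  · exact out
  · intro z hz hzA
    refine (hB z).2 ⟨hz, ?_⟩
    by_contra h
    exact hzA ((hA z).2 ⟨hz, by linarith⟩)
  · intro P₁ hP₁
    refine ⟨fun z hz => ((hP₁ z).1 hz).2, (hP₁ _).2 ⟨hx1Q, hx1A⟩, (hP₁ _).2 ⟨hQ.ht, hτA⟩, ?_, ?_, ?_⟩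
    · intro p hp
      obtain ⟨hpQ, hpA⟩ := (hP₁ p).1 hp
      rw [hD p hpQ hpA, hD τ hQ.ht hτA]
      apply mul_le_mul_of_nonneg_left _ hc0.le
      linarith [hQ.top p hpQ]
    · intro p hp q hq h
      obtain ⟨hpQ, hpA⟩ := (hP₁ p).1 hp
      obtain ⟨hqQ, hqA⟩ := (hP₁ q).1 hq
      rw [hD p hpQ hpA, hD q hqQ hqA] at h
      apply hQ.inj p hpQ q hqQ
      have := mul_left_cancel₀ hc0.ne' h
      rw [← hd]
      linarith
    · intro p hp hpx
      obtain ⟨hpQ, hpA⟩ := (hP₁ p).1 hp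
      obtain ⟨q, hq, hlt, hadj, hwq, hmax⟩ := hchain p (Finset.mem_filter.2 ⟨hpQ, hpA⟩) hpx
      obtain ⟨hqQ, hqA⟩ := Finset.mem_filter.1 hq
      refine ⟨q, (hP₁ q).2 ⟨hqQ, hqA⟩, hadj.1, ?_, ?_⟩
      · rw [hD p hpQ hpA, hD q hqQ hqA]
        linarith
      · intro s hs hsp
        obtain ⟨hsQ, hsA⟩ := (hP₁ s).1 hs
        rw [hD p hpQ hpA, hD s hsQ hsA] at hsp
        rw [hD q hqQ hqA, hD s hsQ hsA]
        have h5 := lt_of_mul_lt_mul_left hsp hc0.le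
        have := hmax s (Finset.mem_filter.2 ⟨hsQ, hsA⟩) (by linarith)
        apply mul_le_mul_of_nonneg_left _ hc0.le
        linarith
  · intro q hq hqA
    exact (hD q hq hqA).le
  · intro z hz
    obtain ⟨p, hp, a1, a2, _, a3⟩ := hradA z hz
    exact ⟨p, hp, a1, a2, a3⟩

lemma petal_step {w w' : Sym2 V → ℝ} {c Δ lo : ℝ} {S Q : Finset V} {x₀ τ : V} {k m : ℕ}
    {μ : V → ℝ} (hk : 1 ≤ k) (hm : 1 ≤ m)
    (hμ : ∀ v, 1 ≤ μ v) (hlog : Real.log (∑ v ∈ S, μ v) ≤ 2 ^ m * Real.log 2)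
    (hw : ∀ e, 0 < w e) (hw' : ∀ e, 0 < w' e) (hle : ∀ e, w' e ≤ w e) (hc0 : 0 < c)
    (hcw : ∀ e, c * w e ≤ w' e) (hS : Conn G S)
    (hQ : IsHwy G S w x₀ τ Q) (hQw : ∀ u ∈ Q, ∀ v ∈ Q, w' s(u, v) ≤ c * w s(u, v))
    (hlo : 0 ≤ lo) (hΔ : 0 < Δ) (hhi : lo + Δ / 8 < spDist (rg G S) w x₀ τ) :
    ∃ (A B : Finset V) (x₁ y : V) (R : ℝ), lo ≤ R ∧ R ≤ lo + Δ / 8 ∧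
      Petal G w w' c (Δ / (128 * (k * m))) S Q A B x₀ τ x₁ y R ∧
      (∑ v ∈ A, μ v) ^ (1 + 1 / (k : ℝ)) + (∑ v ∈ B, μ v) ^ (1 + 1 / (k : ℝ))
        ≤ (∑ v ∈ S, μ v) ^ (1 + 1 / (k : ℝ)) := by
  classical
  obtain ⟨φ, h1, h2⟩ := exists_phi (fun z => spDist (rg G S) w x₀ z)
    (fun a b => spDist (rg G S) w a b) ⟨_, hQ.hx⟩ (spDist (rg G S) w x₀ τ)
  have w0 : ∀ e, 0 ≤ w e := fun e => (hw e).le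
  have hx0S : x₀ ∈ S := hQ.sub hQ.hx
  have hτS : τ ∈ S := hQ.sub hQ.ht
  have hkm : (0 : ℝ) < k * m := by
    have : (1 : ℝ) ≤ k := by exact_mod_cast hk
    have : (1 : ℝ) ≤ m := by exact_mod_cast hm
    positivity
  set δ : ℝ := Δ / (128 * (k * m)) with hδ
  have hδ0 : 0 < δ := by positivity
  have hδΔ : (2 * (k * m)) * (8 * δ) = Δ / 8 := by
    rw [hδ]; field_simp; norm_num
  set g : ℕ → ℝ := fun i => ∑ z ∈ S with φ z ≤ lo + i * (8 * δ), μ z with hg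
  have hμ0 : ∀ v, 0 ≤ μ v := fun v => by linarith [hμ v]
  have hmono : Monotone g := by
    intro i j hij
    apply Finset.sum_le_sum_of_subset_of_nonneg
    · intro z hz
      rw [Finset.mem_filter] at hz ⊢
      refine ⟨hz.1, hz.2.trans ?_⟩
      have : (i : ℝ) ≤ j := by exact_mod_cast hij
      gcongr
    · intro z _ _
      exact hμ0 z
  have pτ : φ τ ≤ 0 := by
    have := h1 τ τ hQ.ht
    rw [spd_self w0] at this
    linarith
  have pc : spDist (rg G S) w x₀ τ ≤ φ x₀ := by
    obtain ⟨p, hp, he⟩ := h2 x₀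
    rw [spd_self w0] at he
    have := spd_nonneg (H := rg G S) w0 x₀ p
    have := spd_nonneg (H := rg G S) w0 p x₀
    linarith
  have hg0 : 1 ≤ g 0 := by
    refine (hμ τ).trans ?_
    apply Finset.single_le_sum (f := μ) (fun z _ => hμ0 z)
    rw [Finset.mem_filter]
    exact ⟨hτS, by push_cast; linarith⟩
  have hcompl : ∀ t : ℝ, (∑ z ∈ S with φ z ≤ t, μ z) + ∑ z ∈ S with t < φ z, μ z
      = ∑ z ∈ S, μ z := by
    intro t
    rw [← Finset.sum_filter_add_sum_filter_not S (fun z => φ z ≤ t)]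
    simp only [not_le]
  have hgn : g (2 * (k * m)) ≤ (∑ v ∈ S, μ v) - 1 := by
    have h := hcompl (lo + ((2 * (k * m) : ℕ) : ℝ) * (8 * δ))
    have : 1 ≤ ∑ z ∈ S with lo + ((2 * (k * m) : ℕ) : ℝ) * (8 * δ) < φ z, μ z := by
      refine (hμ x₀).trans ?_
      apply Finset.single_le_sum (f := μ) (fun z _ => hμ0 z)
      rw [Finset.mem_filter]
      refine ⟨hx0S, ?_⟩
      push_cast
      linarith
    simp only [hg]
    linarith
  obtain ⟨i, hi, hcut⟩ := cut hk hm hmono hg0 hgn hlog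
  have hi' : ((i : ℝ) + 1) * (8 * δ) ≤ Δ / 8 := by
    rw [← hδΔ]
    have : ((i + 1 : ℕ) : ℝ) ≤ ((2 * (k * m) : ℕ) : ℝ) := by exact_mod_cast hi
    push_cast at this
    gcongr
  have hi0 : 0 ≤ (i : ℝ) * (8 * δ) := by positivity
  set r := lo + (i : ℝ) * (8 * δ) with hr
  have hR : lo + ((i + 1 : ℕ) : ℝ) * (8 * δ) = r + 8 * δ := by rw [hr]; push_cast; ring
  obtain ⟨x₁, y, hpet⟩ := petal_geom (A := S.filter (fun z => φ z ≤ r + 8 * δ))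
    (B := S.filter (fun z => r < φ z)) (r := r) (R := r + 8 * δ) hw hw' hle hc0 hcw hS hQ hQw
    (by linarith) le_rfl hδ0 (by linarith) φ h1 h2 (by simp) (by simp)
  refine ⟨_, _, x₁, y, r + 8 * δ, by linarith, by linarith, hpet, ?_⟩
  have e1 : g (i + 1) = ∑ z ∈ S with φ z ≤ r + 8 * δ, μ z := by
    simp only [hg]
    rw [hR]
  have e2 : (∑ v ∈ S, μ v) - g i = ∑ z ∈ S with r < φ z, μ z := by
    have := hcompl r
    simp only [hg]
    linarith
  rw [← e1, ← e2]
  exact hcut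

end Petal

section Main

variable {V : Type} [Finite V] {G : SimpleGraph V} {w₀ : Sym2 V → ℝ} {μ : V → ℝ}

lemma emb_single {κ K : ℝ} {S P : Finset V} {w : Sym2 V → ℝ} {x₀ : V} (hw : ∀ e, 0 < w e)
    (hw₀ : ∀ e, 0 < w₀ e)
    (hμ : ∀ v, 1 ≤ μ v) (hκ : 0 ≤ κ) (hK : 0 ≤ K) (hS : ∀ z, z ∈ S ↔ z = x₀) (hP : P ⊆ S) :
    Nonempty (Emb G w₀ μ κ K S w x₀ P) := by
  have hS' : S = {x₀} := by ext z; simp [hS]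
  subst hS'
  have h0 : ∀ a b : Unit, spDist (⊥ : SimpleGraph Unit)
      (fun e => w₀ (e.map (fun _ : Unit => x₀))) a b = 0 := fun a b =>
    spd_self (fun e => (hw₀ _).le) _
  refine ⟨⟨Unit, inferInstance, ⊥, fun _ => x₀, (), fun _ => (), ?_, ?_, ?_, rfl, ?_, ?_, ?_, ?_, ?_⟩⟩
  · exact SimpleGraph.IsTree.of_subsingleton
  · intro a; simp
  · intro a b h; simp at h
  · intro v hv; exact (Finset.mem_singleton.1 hv).symm
  · intro a
    rw [h0]
    have := spd_nonneg (H := rg G {x₀}) (fun e => (hw e).le) x₀ x₀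
    positivity
  · intro p hp
    have := hP hp
    refine ⟨(), ?_, ?_⟩
    · exact (Finset.mem_singleton.1 this).symm
    · rw [h0]
      have := spd_nonneg (H := rg G {x₀}) (fun e => (hw e).le) x₀ p
      positivity
  · intro u hu v hv
    refine ⟨(), (Finset.mem_singleton.1 hv).symm, ?_⟩
    rw [h0]
    have := spd_nonneg (H := rg G {x₀}) (fun e => (hw e).le) u v
    positivity
  · simp only [Finset.univ_unique, Finset.sum_const, Finset.card_singleton, one_smul,
      Finset.sum_singleton]
    have h1 := hμ x₀
    calc μ x₀ = μ x₀ ^ (1 : ℝ) := (Real.rpow_one _).symm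
      _ ≤ _ := Real.rpow_le_rpow_of_exponent_le h1 (by linarith)

lemma log_sub {S A : Finset V} {x : V} {b : ℝ} (hμ : ∀ v, 1 ≤ μ v) (hAS : A ⊆ S) (hx : x ∈ A)
    (h : Real.log (∑ v ∈ S, μ v) ≤ b) : Real.log (∑ v ∈ A, μ v) ≤ b := by
  have hμ0 : ∀ v, 0 ≤ μ v := fun v => by linarith [hμ v]
  refine le_trans (Real.log_le_log ?_ ?_) h
  · have := Finset.single_le_sum (f := μ) (fun z _ => hμ0 z) hx
    linarith [hμ x]
  · exact Finset.sum_le_sum_of_subset_of_nonneg hAS (fun z _ _ => hμ0 z)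

lemma main_induct {k m : ℕ} {wm : ℝ} (hk : 1 ≤ k) (hm : 1 ≤ m) (hμ : ∀ v, 1 ≤ μ v)
    (hw₀ : ∀ e, 0 < w₀ e) (hwm : ∀ e, wm ≤ w₀ e) :
    ∀ N n : ℕ, ∀ (S : Finset V) (w : Sym2 V → ℝ) (x₀ t : V) (P : Finset V) (Δ : ℝ),
      S.card ≤ n → 0 < Δ → Δ < (4 / 3 : ℝ) ^ N * (wm / 2) → (∀ e, 0 < w e) → Conn G S →
      IsHwy G S w x₀ t P → (∀ z ∈ S, spDist (rg G S) w x₀ z ≤ Δ) →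
      (∀ u ∈ S, ∀ v ∈ S, G.Adj u v → w₀ s(u, v) ≤ 2 * w s(u, v)) →
      (∀ u ∈ S, ∀ v ∈ S, G.Adj u v → w₀ s(u, v) ≤ w s(u, v) ∨ (u ∈ P ∧ v ∈ P)) →
      Real.log (∑ v ∈ S, μ v) ≤ 2 ^ m * Real.log 2 →
      Nonempty (Emb G w₀ μ (1 / (k : ℝ)) (1024 * (k * m)) S w x₀ P) := by
  classical
  have hkm : (0 : ℝ) < k * m := by
    have : (1 : ℝ) ≤ k := by exact_mod_cast hk
    have : (1 : ℝ) ≤ m := by exact_mod_cast hm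
    positivity
  have hK0 : (0 : ℝ) ≤ 1024 * (k * m) := by positivity
  have hKδ : ∀ Δ : ℝ, 8 * Δ ≤ 1024 * (k * m) * (Δ / (128 * (k * m))) := by
    intro Δ
    apply le_of_eq
    field_simp
    ring
  intro N
  induction N with
  | zero =>
    intro n S w x₀ t P Δ _ hΔ0 hΔ hw hS hP hrad h2 _ _
    apply emb_single hw hw₀ hμ (by positivity) hK0 _ hP.sub
    intro z
    constructor
    · intro hz
      by_contra hne
      have hx0 := hP.sub hP.hx
      have := spd_potential (H := rg G S) (w := w) (fun e => (hw e).le)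
        (fun z => if z = x₀ then 0 else wm / 2) (by
          intro a b hab
          have a1 := h2 a hab.2.1 b hab.2.2 hab.1
          have a2 := hwm s(a, b)
          have a3 := hw s(a, b)
          split_ifs <;> linarith) (hS x₀ hx0 z hz)
      have := hrad z hz
      simp [hne] at *
      linarith
    · rintro rfl
      exact hP.sub hP.hx
  | succ N ihN =>
    intro n
    induction n with
    | zero =>
      intro S w x₀ t P Δ hc _ _ _ _ hP
      have := hP.sub hP.hx
      rw [Finset.card_eq_zero.1 (Nat.le_zero.1 hc)] at this
      simp at this
    | succ n ihn =>
      intro S w x₀ t P Δ hc hΔ0 hΔ hw hS hP hrad h2 hor hlog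
      have w0 : ∀ e, 0 ≤ w e := fun e => (hw e).le
      have hΔ' : 3 / 4 * Δ < (4 / 3 : ℝ) ^ N * (wm / 2) := by
        rw [pow_succ] at hΔ
        linarith
      have hcard : ∀ B : Finset V, ∀ τ ∈ S, B ⊆ S → τ ∉ B → B.card ≤ n := by
        intro B τ hτ hB hτB
        have : B.card < S.card := Finset.card_lt_card
          ((Finset.ssubset_iff_of_subset hB).2 ⟨τ, hτ, hτB⟩)
        omega
      rcases lt_or_ge (5 / 8 * Δ) (spDist (rg G S) w x₀ t) with ht | ht
      · have _type_one := trivial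
        have htΔ := hrad t (hP.sub hP.ht)
        obtain ⟨A, B, x₁, y, R, hR1, hR2, hp, hcost⟩ := petal_step (w := w) (w' := w) (c := 1)
          (Δ := Δ) (lo := spDist (rg G S) w x₀ t - 5 / 8 * Δ) hk hm hμ hlog hw hw
          (fun _ => le_rfl) one_pos (by simp) hS hP (by simp) (by linarith) hΔ0 (by linarith)
        have hx1R := hp.out x₁ hp.hx1
        have hradA : ∀ z ∈ A, spDist (rg G A) w x₁ z ≤ 3 / 4 * Δ := by
          intro z hz
          obtain ⟨p, hpQ, a1, a2, a3⟩ := hp.rad z hz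
          have := hrad z (hp.hAS hz)
          linarith
        obtain ⟨t₀, ht₀⟩ := hwy_rest hw hp.hBS hp.hx hS hp.up hP hp.dB (P.filter (· ∈ B))
          (by simp)
        obtain ⟨E₁⟩ := ihn B w x₀ t₀ (P.filter (· ∈ B)) Δ
          (hcard B t (hP.sub hP.ht) hp.hBS hp.hτ) hΔ0 hΔ hw hp.cB ht₀
          (fun z hz => by rw [hp.dB z hz]; exact hrad z (hp.hBS hz))
          (fun u hu v hv => h2 u (hp.hBS hu) v (hp.hBS hv))
          (fun u hu v hv h => by
            rcases hor u (hp.hBS hu) v (hp.hBS hv) h with h' | ⟨h', h''⟩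
            · exact Or.inl h'
            · exact Or.inr ⟨Finset.mem_filter.2 ⟨h', hu⟩, Finset.mem_filter.2 ⟨h'', hv⟩⟩)
          (log_sub hμ hp.hBS hp.hx hlog)
        obtain ⟨E₂⟩ := ihN A.card A w x₁ t (P.filter (· ∈ A)) (3 / 4 * Δ) le_rfl (by linarith)
          hΔ' hw hp.cA (hp.hwy _ (by simp)) hradA
          (fun u hu v hv => h2 u (hp.hAS hu) v (hp.hAS hv))
          (fun u hu v hv h => by
            rcases hor u (hp.hAS hu) v (hp.hAS hv) h with h' | ⟨h', h''⟩
            · exact Or.inl h'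
            · exact Or.inr ⟨Finset.mem_filter.2 ⟨h', hu⟩, Finset.mem_filter.2 ⟨h'', hv⟩⟩)
          (log_sub hμ hp.hAS hp.hx1 hlog)
        obtain ⟨y', hy', hyd⟩ := E₁.hwy y (Finset.mem_filter.2 ⟨hp.yQ, hp.yB⟩)
        rw [hp.dB y hp.yB] at hyd
        have hyx := h2 y (hp.hBS hp.yB) x₁ (hp.hAS hp.hx1) hp.adj
        have hyle := hp.hy
        refine glue_emb (δ := Δ / (128 * (k * m))) hw₀ hw E₁ E₂ hp.hAS hp.hBS hrad hp.pad
          (fun z hz => (hp.dB z hz).le) hp.adj y' hy' hyd ?_ ?_ hK0 (hKδ Δ) hcost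
        · intro z hz
          obtain ⟨p, hpQ, a1, a2, a3⟩ := hp.rad z hz
          linarith
        · intro p hpP
          by_cases hpA : p ∈ A
          · right
            refine ⟨Finset.mem_filter.2 ⟨hpP, hpA⟩, ?_⟩
            have := hp.hwyd p hpP hpA
            linarith
          · have hpB := hp.cov p (hP.sub hpP) hpA
            exact Or.inl ⟨Finset.mem_filter.2 ⟨hpP, hpB⟩, hpB⟩
      · by_cases hall : ∀ z ∈ S, spDist (rg G S) w x₀ z ≤ 3 / 4 * Δ
        · exact ihN S.card S w x₀ t P (3 / 4 * Δ) le_rfl (by linarith) hΔ' hw hS hP hall h2 hor hlog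
        · have _type_two := trivial
          push Not at hall
          obtain ⟨τ, hτS, hτ⟩ := hall
          have hτΔ := hrad τ hτS
          obtain ⟨Q, hQ⟩ := exists_hwy hw hS (hP.sub hP.hx) hτS
          set w' : Sym2 V → ℝ := fun e => if ∀ x ∈ e, x ∈ Q then w e / 2 else w e with hw'def
          have hw' : ∀ e, 0 < w' e := by
            intro e
            have := hw e
            simp only [hw'def]
            split_ifs <;> linarith
          have hle : ∀ e, w' e ≤ w e := by
            intro e
            have := hw e
            simp only [hw'def]
            split_ifs <;> linarith
          have hcw : ∀ e, 1 / 2 * w e ≤ w' e := by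
            intro e
            have := hw e
            simp only [hw'def]
            split_ifs <;> linarith
          have hQw : ∀ u ∈ Q, ∀ v ∈ Q, w' s(u, v) ≤ 1 / 2 * w s(u, v) := by
            intro u hu v hv
            have : ∀ x ∈ s(u, v), x ∈ Q := by
              intro x hx
              rcases Sym2.mem_iff.1 hx with rfl | rfl <;> assumption
            simp only [hw'def]
            rw [if_pos this]
            linarith
          obtain ⟨A, B, x₁, y, R, hR1, hR2, hp, hcost⟩ := petal_step (w := w) (w' := w')
            (c := 1 / 2) (Δ := Δ) (lo := 0) hk hm hμ hlog hw hw'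
            hle (by norm_num) hcw hS hQ hQw le_rfl hΔ0 (by linarith)
          have hx1R := hp.out x₁ hp.hx1
          have hyR := hp.hyR
          have hAP : ∀ z ∈ A, z ∉ P := by
            intro z hz hzP
            have := hp.out z hz
            have := hP.top z hzP
            linarith
          have hPB : ∀ z ∈ P, z ∈ B := fun z hz =>
            hp.cov z (hP.sub hz) (fun h => hAP z h hz)
          have hradA : ∀ z ∈ A, spDist (rg G A) w' x₁ z ≤ 3 / 4 * Δ := by
            intro z hz
            obtain ⟨p, hpQ, a1, a2, a3⟩ := hp.rad z hz
            have := hrad z (hp.hAS hz)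
            linarith
          have hwA : ∀ u ∈ A, ∀ v ∈ A, G.Adj u v → w₀ s(u, v) ≤ w s(u, v) := by
            intro u hu v hv h
            rcases hor u (hp.hAS hu) v (hp.hAS hv) h with h' | ⟨h', _⟩
            · exact h'
            · exact absurd h' (hAP u hu)
          obtain ⟨t₀, ht₀⟩ := hwy_rest hw hp.hBS hp.hx hS hp.up hP hp.dB P
            (fun z => ⟨fun h => ⟨h, hPB z h⟩, fun h => h.1⟩)
          obtain ⟨E₁⟩ := ihn B w x₀ t₀ P Δ
            (hcard B τ hτS hp.hBS hp.hτ) hΔ0 hΔ hw hp.cB ht₀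
            (fun z hz => by rw [hp.dB z hz]; exact hrad z (hp.hBS hz))
            (fun u hu v hv => h2 u (hp.hBS hu) v (hp.hBS hv))
            (fun u hu v hv h => hor u (hp.hBS hu) v (hp.hBS hv) h)
            (log_sub hμ hp.hBS hp.hx hlog)
          obtain ⟨E₂⟩ := ihN A.card A w' x₁ τ (Q.filter (· ∈ A)) (3 / 4 * Δ) le_rfl (by linarith)
            hΔ' hw' hp.cA (hp.hwy _ (by simp)) hradA
            (fun u hu v hv h => by linarith [hwA u hu v hv h, hcw s(u, v)])
            (fun u hu v hv h => by
              by_cases hq : u ∈ Q ∧ v ∈ Q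
              · exact Or.inr ⟨Finset.mem_filter.2 ⟨hq.1, hu⟩, Finset.mem_filter.2 ⟨hq.2, hv⟩⟩
              · left
                have : ¬ ∀ x ∈ s(u, v), x ∈ Q := by
                  intro h'
                  exact hq ⟨h' u (by simp), h' v (by simp)⟩
                simp only [hw'def]
                rw [if_neg this]
                exact hwA u hu v hv h)
            (log_sub hμ hp.hAS hp.hx1 hlog)
          have hyd := E₁.rad (E₁.χ y)
          rw [E₁.hχ y hp.yB, hp.dB y hp.yB] at hyd
          have hyx : w₀ s(y, x₁) ≤ w s(y, x₁) := by
            rcases hor y (hp.hBS hp.yB) x₁ (hp.hAS hp.hx1) hp.adj with h' | ⟨_, h'⟩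
            · exact h'
            · exact absurd h' (hAP x₁ hp.hx1)
          have hyle := hp.hy
          refine glue_emb (δ := Δ / (128 * (k * m))) hw₀ hw E₁ E₂ hp.hAS hp.hBS hrad hp.pad
            (fun z hz => (hp.dB z hz).le) hp.adj (E₁.χ y) (E₁.hχ y hp.yB) hyd ?_ ?_ hK0
            (hKδ Δ) hcost
          · intro z hz
            obtain ⟨p, hpQ, a1, a2, a3⟩ := hp.rad z hz
            linarith
          · intro p hpP
            exact Or.inl ⟨hpP, hPB p hpP⟩

end Main

section Final

variable {V : Type} [Fintype V] {G : SimpleGraph V}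

lemma core (hn : 2 ≤ Fintype.card V) (hG : G.Connected) {wG : Sym2 V → ℝ}
    (hwG : ∀ e ∈ G.edgeSet, 0 < wG e) {μ : V → ℝ} (hμ : ∀ v, 1 ≤ μ v) {k m : ℕ} (hk : 1 ≤ k)
    (hm : 1 ≤ m) (hlog : Real.log (∑ v, μ v) ≤ 2 ^ m * Real.log 2) {t : ℝ}
    (ht : 1024 * (k * m) ≤ t) :
    ∃ (Y : Type) (_ : Fintype Y) (T : SimpleGraph Y) (wT : Sym2 Y → ℝ)
      (f : V → Finset Y) (χ : V → Y), IsSpanningClanTree G wG T wT f χ t ∧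
      ∑ v, μ v * ((f v).card : ℝ) ≤ (∑ v, μ v) ^ (1 + 1 / (k : ℝ)) := by
  classical
  have hne : Nonempty V := hG.nonempty
  obtain ⟨x₀⟩ := id hne
  set w₀ : Sym2 V → ℝ := fun e => if e ∈ G.edgeSet then wG e else 1 with hw₀def
  have hw₀ : ∀ e, 0 < w₀ e := by
    intro e
    simp only [hw₀def]
    split_ifs with h
    · exact hwG e h
    · exact one_pos
  have w0 : ∀ e, 0 ≤ w₀ e := fun e => (hw₀ e).le
  have heq : ∀ u v, spDist G wG u v = spDist G w₀ u v := by
    intro u v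
    unfold spDist
    congr 2
    funext p
    congr 1
    apply List.map_congr_left
    intro e he
    simp only [hw₀def]
    rw [if_pos (p.edges_subset_edgeSet he)]
  have hrg : rg G Finset.univ = G := by
    ext a b
    simp [rg]
  have : Nonempty (Sym2 V) := ⟨s(x₀, x₀)⟩
  obtain ⟨e₀, he₀⟩ := Finite.exists_min w₀
  have hwm0 := hw₀ e₀
  set Δ : ℝ := 1 + ∑ z, spDist G w₀ x₀ z with hΔ
  have hsum : 0 ≤ ∑ z, spDist G w₀ x₀ z := Finset.sum_nonneg fun z _ => spd_nonneg w0 x₀ z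
  have hΔ0 : 0 < Δ := by linarith
  obtain ⟨N, hN⟩ := pow_unbounded_of_one_lt (Δ / (w₀ e₀ / 2)) (show (1 : ℝ) < 4 / 3 by norm_num)
  rw [div_lt_iff₀ (by linarith)] at hN
  have hEmb := main_induct (G := G) (w₀ := w₀) hk hm hμ hw₀ he₀ N (Finset.univ : Finset V).card
    Finset.univ w₀ x₀ x₀ {x₀} Δ le_rfl hΔ0 hN hw₀
    (by intro u _ v _; rw [hrg]; exact hG.preconnected u v)
    (hwy_single (Finset.mem_univ _))
    (by
      intro z _
      rw [hrg]
      have := Finset.single_le_sum (f := fun z => spDist G w₀ x₀ z)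
        (fun z _ => spd_nonneg w0 x₀ z) (Finset.mem_univ z)
      linarith)
    (by intro u _ v _ _; linarith [hw₀ s(u, v)])
    (by intro u _ v _ _; exact Or.inl le_rfl) hlog
  obtain ⟨Y, fin, T, π, root, χ, tree, mem, adj, hroot, hχ, rad, hwy, dist, cost⟩ := hEmb
  rw [hrg] at dist
  have hWe : ∀ a b, T.Adj a b → w₀ (s(a, b).map π) = wG s(π a, π b) := by
    intro a b h
    rw [Sym2.map_mk]
    simp only [hw₀def]
    exact if_pos (adj a b h)
  refine ⟨Y, fin, T, fun e => w₀ (e.map π), fun v => Finset.univ.filter (fun a => π a = v), χ,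
    ⟨tree, ?_, ?_, ?_, ?_, ?_, ?_, ?_, ?_⟩, ?_⟩
  · intro e _
    exact hw₀ _
  · intro v
    exact ⟨χ v, Finset.mem_filter.2 ⟨Finset.mem_univ _, hχ v (Finset.mem_univ _)⟩⟩
  · intro u v huv
    rw [Finset.disjoint_left]
    intro a ha hb
    exact huv ((Finset.mem_filter.1 ha).2.symm.trans (Finset.mem_filter.1 hb).2)
  · intro y
    exact ⟨π y, by simp⟩
  · intro u v u' v' hu hv h
    obtain rfl := (Finset.mem_filter.1 hu).2
    obtain rfl := (Finset.mem_filter.1 hv).2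
    exact ⟨adj _ _ h, hWe _ _ h⟩
  · intro u v _ u' hu v' hv
    obtain rfl := (Finset.mem_filter.1 hu).2
    obtain rfl := (Finset.mem_filter.1 hv).2
    rw [heq]
    exact spd_map (H := T) (w := fun e => w₀ (e.map π)) (fun e => w0 _) w0
      (⟨π, fun {a b} h => adj a b h⟩ : T →g G) (fun a b _ => by
        rw [Sym2.map_mk]; exact le_rfl) (tree.connected.preconnected u' v')
  · intro v
    exact Finset.mem_filter.2 ⟨Finset.mem_univ _, hχ v (Finset.mem_univ _)⟩
  · intro u v
    obtain ⟨a, ha, had⟩ := dist u (Finset.mem_univ _) v (Finset.mem_univ _)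
    refine ⟨a, Finset.mem_filter.2 ⟨Finset.mem_univ _, ha⟩, ?_⟩
    rw [spd_symm, heq]
    exact had.trans (mul_le_mul_of_nonneg_right ht (spd_nonneg w0 u v))
  · refine le_trans (le_of_eq ?_) cost
    rw [← Finset.sum_fiberwise Finset.univ π (fun a => μ (π a))]
    apply Finset.sum_congr rfl
    intro v _
    rw [Finset.sum_congr rfl (g := fun _ => μ v) (by
      intro a ha
      rw [(Finset.mem_filter.1 ha).2])]
    rw [Finset.sum_const, nsmul_eq_mul, mul_comm]

/-- The core result with the measure `1 + n μ` and the choice of `m`. -/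
lemma core2 (hn : 2 ≤ Fintype.card V) (hG : G.Connected) {wG : Sym2 V → ℝ}
    (hwG : ∀ e ∈ G.edgeSet, 0 < wG e) {μ : V → ℝ} (hμ : ∀ v, 0 ≤ μ v) (hμ1 : ∑ v, μ v = 1)
    {k : ℕ} (hk : 1 ≤ k) {t : ℝ}
    (ht : 2048 * k * (1 + Real.logb 2 (Real.logb 2 (Fintype.card V))) ≤ t) :
    ∃ (Y : Type) (_ : Fintype Y) (T : SimpleGraph Y) (wT : Sym2 Y → ℝ)
      (f : V → Finset Y) (χ : V → Y), IsSpanningClanTree G wG T wT f χ t ∧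
      1 + ∑ v, μ v * ((f v).card : ℝ) ≤ 2 * (2 * (Fintype.card V : ℝ)) ^ (1 / (k : ℝ)) := by
  set n : ℝ := (Fintype.card V : ℝ) with hndef
  have hn2 : (2 : ℝ) ≤ n := by rw [hndef]; exact_mod_cast hn
  set L := Real.logb 2 n with hL
  have hL1 : 1 ≤ L := by
    rw [hL, Real.le_logb_iff_rpow_le one_lt_two (by linarith)]
    simpa using hn2
  have hl0 : 0 ≤ Real.logb 2 L := Real.logb_nonneg one_lt_two hL1
  set m : ℕ := ⌈Real.logb 2 L⌉₊ + 1 with hm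
  have hm2 : (m : ℝ) ≤ 2 * (1 + Real.logb 2 L) := by
    have := Nat.ceil_lt_add_one hl0
    rw [hm]
    push_cast
    linarith
  have hpow : 2 * L ≤ 2 ^ m := by
    have h1 : L ≤ (2 : ℝ) ^ ⌈Real.logb 2 L⌉₊ := by
      rw [← Real.rpow_natCast, ← Real.logb_le_iff_le_rpow one_lt_two (by linarith)]
      exact Nat.le_ceil _
    rw [hm, pow_succ]
    linarith
  have hsum : ∑ v, (1 + n * μ v) = 2 * n := by
    rw [Finset.sum_add_distrib, ← Finset.mul_sum, hμ1]
    simp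
    ring
  have hlog : Real.log (∑ v, (1 + n * μ v)) ≤ 2 ^ m * Real.log 2 := by
    have h2 : 0 < Real.log 2 := Real.log_pos one_lt_two
    rw [hsum, Real.log_mul (by norm_num) (by linarith)]
    have h3 : Real.log n = L * Real.log 2 := by
      rw [hL, Real.logb, div_mul_cancel₀ _ h2.ne']
    rw [h3]
    nlinarith
  have hk1 : (1 : ℝ) ≤ k := by exact_mod_cast hk
  obtain ⟨Y, fin, T, wT, f, χ, hcl, hcost⟩ := core (t := t) (μ := fun v => 1 + n * μ v) hn hG hwG
    (fun v => by nlinarith [hμ v]) hk (Nat.le_add_left _ _) hlog (by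
      refine le_trans ?_ ht
      nlinarith)
  refine ⟨Y, fin, T, wT, f, χ, hcl, ?_⟩
  rw [hsum, rpow_split (by linarith)] at hcost
  have h1 : n ≤ ∑ v, ((f v).card : ℝ) := by
    have : ∑ _v : V, (1 : ℝ) ≤ ∑ v, ((f v).card : ℝ) := by
      apply Finset.sum_le_sum
      intro v _
      exact_mod_cast Finset.card_pos.2 (hcl.2.2.1 v)
    simpa using this
  have h2 : ∑ v, (1 + n * μ v) * ((f v).card : ℝ)
      = ∑ v, ((f v).card : ℝ) + n * ∑ v, μ v * ((f v).card : ℝ) := by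
    rw [Finset.mul_sum, ← Finset.sum_add_distrib]
    apply Finset.sum_congr rfl
    intro v _
    ring
  rw [h2] at hcost
  have hn0 : 0 < n := by linarith
  refine le_of_mul_le_mul_left ?_ hn0
  linarith

end Final
end Clan

theorem spanning_clan_embedding_probability :
    ∃ C : ℝ, 0 < C ∧
      ∀ (V : Type) [Fintype V], ∀ (G : SimpleGraph V) (wG : Sym2 V → ℝ),
        2 ≤ Fintype.card V → G.Connected → (∀ e ∈ G.edgeSet, 0 < wG e) →
        ∀ μ : V → ℝ, (∀ v, 0 ≤ μ v) → (∑ v, μ v = 1) →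
        (∀ k : ℕ, 1 ≤ k →
          ∃ (Y : Type) (_ : Fintype Y) (T : SimpleGraph Y) (wT : Sym2 Y → ℝ)
            (f : V → Finset Y) (χ : V → Y),
            IsSpanningClanTree G wG T wT f χ
              (C * (k : ℝ) * (1 + Real.logb 2 (Real.logb 2 (Fintype.card V)))) ∧
            ∑ v, μ v * ((f v).card : ℝ) ≤ C * (Fintype.card V : ℝ) ^ (1 / (k : ℝ))) ∧
        (∀ ε : ℝ, 0 < ε → ε ≤ 1 →
          ∃ (Y : Type) (_ : Fintype Y) (T : SimpleGraph Y) (wT : Sym2 Y → ℝ)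
            (f : V → Finset Y) (χ : V → Y),
            IsSpanningClanTree G wG T wT f χ
              (C * Real.logb 2 (Fintype.card V) *
                (1 + Real.logb 2 (Real.logb 2 (Fintype.card V))) / ε) ∧
            ∑ v, μ v * ((f v).card : ℝ) ≤ 1 + ε) := by
  refine ⟨20000, by norm_num, ?_⟩
  intro V _ G wG hn hG hwG μ hμ hμ1
  have hn2 : (2 : ℝ) ≤ (Fintype.card V : ℝ) := by exact_mod_cast hn
  have hL1 : 1 ≤ Real.logb 2 (Fintype.card V : ℝ) := by
    rw [Real.le_logb_iff_rpow_le one_lt_two (by linarith)]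
    simpa using hn2
  have hl0 : 0 ≤ Real.logb 2 (Real.logb 2 (Fintype.card V : ℝ)) := Real.logb_nonneg one_lt_two hL1
  have hnL : (Fintype.card V : ℝ) = 2 ^ Real.logb 2 (Fintype.card V : ℝ) :=
    (Real.rpow_logb (by norm_num) (by norm_num) (by linarith)).symm
  constructor
  · intro k hk
    have hk1 : (1 : ℝ) ≤ k := by exact_mod_cast hk
    obtain ⟨Y, fin, T, wT, f, χ, h1, h2⟩ := Clan.core2 hn hG hwG hμ hμ1 hk
      (t := 20000 * (k : ℝ) * (1 + Real.logb 2 (Real.logb 2 (Fintype.card V))))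
      (by gcongr; norm_num)
    refine ⟨Y, fin, T, wT, f, χ, h1, ?_⟩
    rw [Real.mul_rpow (by norm_num) (by linarith)] at h2
    have h3 : (2 : ℝ) ^ (1 / (k : ℝ)) ≤ 2 := by
      calc (2 : ℝ) ^ (1 / (k : ℝ)) ≤ 2 ^ (1 : ℝ) :=
            Real.rpow_le_rpow_of_exponent_le one_le_two
              ((div_le_one (by linarith)).2 hk1)
        _ = 2 := Real.rpow_one _
    have h4 : 0 ≤ (Fintype.card V : ℝ) ^ (1 / (k : ℝ)) := by positivity
    nlinarith
  · intro ε hε hε1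
    generalize hLdef : Real.logb 2 (Fintype.card V : ℝ) = L at *
    set j : ℕ := ⌈2 / ε⌉₊ with hj
    set l : ℕ := ⌈1 + L⌉₊ with hl
    have hj1 : 2 / ε ≤ j := Nat.le_ceil _
    have hj2 : (j : ℝ) ≤ 3 / ε := by
      have h := Nat.ceil_lt_add_one (show 0 ≤ 2 / ε by positivity)
      have h' : 1 ≤ 1 / ε := (one_le_div hε).2 hε1
      have h'' : 3 / ε = 2 / ε + 1 / ε := by ring
      rw [h'']
      linarith
    have hl1 : 1 + L ≤ l := Nat.le_ceil _
    have hl2 : (l : ℝ) ≤ 3 * L := by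
      have h := Nat.ceil_lt_add_one (show 0 ≤ 1 + L by linarith)
      linarith
    have hj0 : 0 < j := Nat.ceil_pos.2 (by positivity)
    have hl0' : 0 < l := Nat.ceil_pos.2 (by linarith)
    have hk : 1 ≤ j * l := Nat.mul_pos hj0 hl0'
    have hkr : (((j * l : ℕ) : ℝ)) ≤ 9 * L / ε := by
      push_cast
      calc (j : ℝ) * l ≤ (3 / ε) * (3 * L) := by gcongr
        _ = 9 * L / ε := by ring
    obtain ⟨Y, fin, T, wT, f, χ, h1, h2⟩ := Clan.core2 hn hG hwG hμ hμ1 hk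
      (t := 20000 * L * (1 + Real.logb 2 L) / ε)
      (by
        rw [hLdef]
        have : 0 ≤ L * (1 + Real.logb 2 L) / ε := by
          have : 0 ≤ 1 + Real.logb 2 L := by linarith
          have : 0 ≤ L := by linarith
          positivity
        calc 2048 * ((j * l : ℕ) : ℝ) * (1 + Real.logb 2 L)
            ≤ 2048 * (9 * L / ε) * (1 + Real.logb 2 L) := by gcongr
          _ = 18432 * (L * (1 + Real.logb 2 L) / ε) := by ring
          _ ≤ 20000 * (L * (1 + Real.logb 2 L) / ε) := by gcongr; norm_num
          _ = _ := by ring)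
    refine ⟨Y, fin, T, wT, f, χ, h1, ?_⟩
    have hb : (2 : ℝ) ≤ (1 + ε / 2) ^ j := by
      have := one_add_mul_le_pow (show (-2 : ℝ) ≤ ε / 2 by linarith) j
      rw [div_le_iff₀ hε] at hj1
      linarith
    have h2n : 2 * (Fintype.card V : ℝ) ≤ (1 + ε / 2) ^ (j * l) := by
      rw [pow_mul]
      calc 2 * (Fintype.card V : ℝ) = 2 ^ (1 + L) := by
            rw [Real.rpow_add (by norm_num), Real.rpow_one, ← hnL]
        _ ≤ 2 ^ (l : ℝ) := Real.rpow_le_rpow_of_exponent_le one_le_two hl1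
        _ = 2 ^ l := Real.rpow_natCast _ _
        _ ≤ _ := by gcongr
    have h5 : (2 * (Fintype.card V : ℝ)) ^ (1 / ((j * l : ℕ) : ℝ)) ≤ 1 + ε / 2 := by
      calc (2 * (Fintype.card V : ℝ)) ^ (1 / ((j * l : ℕ) : ℝ))
          ≤ ((1 + ε / 2) ^ (j * l)) ^ (1 / ((j * l : ℕ) : ℝ)) :=
            Real.rpow_le_rpow (by positivity) h2n (by positivity)
        _ = 1 + ε / 2 := by
            rw [one_div]
            exact Real.pow_rpow_inv_natCast (by positivity) (by omega)
    linarith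
end

section
/- Let lo < hi be real numbers, set R = hi − lo and mid = lo + R/2. Let M ≥ 2 be a real number and let L = ⌈1 + log₂ log₂ M⌉. Let w : ℝ → ℝ be a nondecreasing function with w(lo) ≥ 1 and w(mid) ≤ M/2. Then there exist reals a, b with lo ≤ a < b ≤ mid, b − a = R/(2L), and w(a) ≥ w(b)²/M. -/
/-- interval-selection lemma: for a nondecreasing `w` with `w(lo) ≥ 1`
and `w(mid) ≤ M/2`, where `mid = lo + (hi−lo)/2` and `L = ⌈1 + log₂ log₂ M⌉`, there is a
subinterval `[a,b] ⊆ [lo, mid]` of length `(hi−lo)/(2L)` with `w(a) ≥ w(b)²/M`. -/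
theorem interval_selection
    (lo hi : ℝ) (hlh : lo < hi) (M : ℝ) (hM : 2 ≤ M)
    (w : ℝ → ℝ) (hw : Monotone w) (hwlo : 1 ≤ w lo)
    (hwmid : w (lo + (hi - lo) / 2) ≤ M / 2) :
    ∃ a b : ℝ, lo ≤ a ∧ a < b ∧ b ≤ lo + (hi - lo) / 2 ∧
      b - a = (hi - lo) / (2 * (⌈(1 : ℝ) + Real.logb 2 (Real.logb 2 M)⌉₊ : ℝ)) ∧
      (w b) ^ 2 / M ≤ w a := by
  have hM0 : 0 < M := by linarith
  have hl1 : 1 ≤ Real.logb 2 M := by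
    rw [Real.le_logb_iff_rpow_le (by norm_num) hM0]; simpa using hM
  have hl2 : 0 ≤ Real.logb 2 (Real.logb 2 M) := Real.logb_nonneg (by norm_num) hl1
  have hceil := Nat.le_ceil ((1 : ℝ) + Real.logb 2 (Real.logb 2 M))
  set L : ℕ := ⌈(1 : ℝ) + Real.logb 2 (Real.logb 2 M)⌉₊ with hL
  have hL1 : (1 : ℝ) ≤ L := by linarith
  have hL0 : (0 : ℝ) < L := by linarith
  have hpow : Real.logb 2 M ≤ (2 : ℝ) ^ L := by
    have h : Real.logb 2 (Real.logb 2 M) ≤ (L : ℝ) := by linarith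
    rw [Real.logb_le_iff_le_rpow (by norm_num) (by linarith)] at h
    simpa using h
  have hM2 : M ≤ (2 : ℝ) ^ (2 ^ L) := by
    rw [Real.logb_le_iff_le_rpow (by norm_num) hM0] at hpow
    have e : ((2 : ℝ) ^ L) = ((2 ^ L : ℕ) : ℝ) := by push_cast; rfl
    rw [e, Real.rpow_natCast] at hpow
    exact hpow
  set d : ℝ := (hi - lo) / (2 * (L : ℝ)) with hd
  have hd0 : 0 < d := div_pos (by linarith) (by linarith)
  have hLd : L * d = (hi - lo) / 2 := by rw [hd]; field_simp
  by_contra hcon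
  push Not at hcon
  have step : ∀ k : ℕ, k < L → w (lo + k * d) / M < (w (lo + (k + 1 : ℕ) * d) / M) ^ 2 := by
    intro k hk
    have hk1 : ((k + 1 : ℕ) : ℝ) ≤ L := by exact_mod_cast hk
    have h0 : 0 ≤ (k : ℝ) * d := by positivity
    have h1 : ((k + 1 : ℕ) : ℝ) * d ≤ L * d := mul_le_mul_of_nonneg_right hk1 hd0.le
    have := hcon (lo + k * d) (lo + (k + 1 : ℕ) * d) (by linarith)
      (by push_cast; linarith) (by linarith) (by push_cast; ring)
    have h2 := div_lt_div_of_pos_right this hM0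
    calc _ < _ := h2
      _ = _ := by field_simp
  have pos : ∀ k : ℕ, 0 ≤ w (lo + k * d) / M := by
    intro k
    have h0 : 0 ≤ (k : ℝ) * d := by positivity
    have := hw (show lo ≤ lo + k * d by linarith)
    exact div_nonneg (by linarith) hM0.le
  have ind : ∀ k : ℕ, k < L → w lo / M < (w (lo + (k + 1 : ℕ) * d) / M) ^ (2 ^ (k + 1)) := by
    intro k
    induction k with
    | zero => intro h; simpa using step 0 h
    | succ n ih =>
      intro h
      refine (ih (by omega)).trans ?_
      rw [pow_succ 2 (n + 1), mul_comm (2 ^ (n + 1)) 2, pow_mul]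
      exact pow_lt_pow_left₀ (step (n + 1) h) (pos _) (by positivity)
  have hLn : 0 < L := by exact_mod_cast hL0
  have fin := ind (L - 1) (by omega)
  rw [Nat.sub_add_cancel hLn, hLd] at fin
  have p := pos L
  rw [hLd] at p
  have hhalf : w (lo + (hi - lo) / 2) / M ≤ 1 / 2 := by
    rw [div_le_iff₀ hM0]; linarith
  have h3 := pow_le_pow_left₀ p hhalf (2 ^ L)
  have h4 : ((1 : ℝ) / 2) ^ (2 ^ L) ≤ 1 / M := by
    rw [div_pow, one_pow]
    exact one_div_le_one_div_of_le hM0 hM2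
  have h5 : 1 / M ≤ w lo / M := div_le_div_of_nonneg_right hwlo hM0.le
  linarith
end

section
/- Let a < b be real numbers, let k ≥ 1 be an integer, and let w : ℝ → ℝ be a nondecreasing function with w(a) > 0. Then there exists r ∈ [a + (b−a)/(2k), b − (b−a)/(2k)] such that w(r + (b−a)/(2k)) ≤ w(r − (b−a)/(2k)) · (w(b)/w(a))^{1/k}. -/
/-- radius-selection lemma: for a nondecreasing `w` with `w(a) > 0`,
there is `r ∈ [a + (b−a)/(2k), b − (b−a)/(2k)]` with
`w(r + (b−a)/(2k)) ≤ w(r − (b−a)/(2k)) · (w(b)/w(a))^{1/k}`. -/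
theorem radius_selection
    (a b : ℝ) (hab : a < b) (k : ℕ) (hk : 1 ≤ k)
    (w : ℝ → ℝ) (hw : Monotone w) (hwa : 0 < w a) :
    ∃ r : ℝ, a + (b - a) / (2 * (k : ℝ)) ≤ r ∧ r ≤ b - (b - a) / (2 * (k : ℝ)) ∧
      w (r + (b - a) / (2 * (k : ℝ))) ≤
        w (r - (b - a) / (2 * (k : ℝ))) * (w b / w a) ^ (1 / (k : ℝ)) := by
  have hk0 : (0 : ℝ) < k := by exact_mod_cast hk
  obtain ⟨d, hd⟩ : ∃ d, d = (b - a) / (2 * (k : ℝ)) := ⟨_, rfl⟩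
  obtain ⟨q, hq⟩ : ∃ q, q = (w b / w a) ^ (1 / (k : ℝ)) := ⟨_, rfl⟩
  rw [← hd, ← hq]
  have hd0 : 0 < d := by
    rw [hd]
    exact div_pos (by linarith) (by linarith)
  have hdk : 2 * d * k = b - a := by
    rw [hd]
    field_simp
  have hwb : 0 < w b := lt_of_lt_of_le hwa (hw hab.le)
  have hq0 : 0 < q := by
    rw [hq]
    exact Real.rpow_pos_of_pos (div_pos hwb hwa) _
  have hqk : q ^ k = w b / w a := by
    rw [hq, one_div]
    exact Real.rpow_inv_natCast_pow (div_pos hwb hwa).le (by omega)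
  by_contra hcon
  push Not at hcon
  have step : ∀ i : ℕ, i < k →
      w (a + 2 * d * i) * q < w (a + 2 * d * ((i + 1 : ℕ) : ℝ)) := by
    intro i hi
    have hi' : (i : ℝ) + 1 ≤ k := by exact_mod_cast hi
    have hi0 : (0 : ℝ) ≤ i := Nat.cast_nonneg i
    have h := hcon (a + 2 * d * i + d) (by nlinarith) (by nlinarith)
    have e1 : a + 2 * d * i + d + d = a + 2 * d * ((i + 1 : ℕ) : ℝ) := by
      push_cast
      ring
    have e2 : a + 2 * d * i + d - d = a + 2 * d * i := by ring
    rwa [e1, e2] at h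
  have main : ∀ i : ℕ, i < k →
      w a * q ^ (i + 1) < w (a + 2 * d * ((i + 1 : ℕ) : ℝ)) := by
    intro i
    induction i with
    | zero =>
      intro hi
      simpa using step 0 hi
    | succ n ih =>
      intro hi
      refine lt_trans ?_ (step (n + 1) hi)
      rw [pow_succ, ← mul_assoc]
      exact mul_lt_mul_of_pos_right (ih (by omega)) hq0
  have h := main (k - 1) (by omega)
  rw [Nat.sub_add_cancel hk, hqk, hdk, mul_div_cancel₀ _ hwa.ne'] at h
  simp at h
end

section
/- Let (X, d_X) be a finite metric space with at least two points, let μ be a (≥1)-measure on X, let k ≥ 1 be an integer, and write D = diam(X). Then there exist a point v ∈ X and a radius R with 0 < R ≤ D/2 such that, setting P = B_X(v, R + D/(8(k+1))), Q = B_X(v, R), and Q̄ = X ∖ Q, the following hold: (1) min{μ(P), μ(Q̄)} ≤ (2/3)·μ(X) and diam(P) ≤ D/2; (2) μ(P) ≤ μ(Q) · (μ*(X)/μ*(P))^{1/k}. -/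
/-- The ball of radius `r` around `v`, restricted to the subset `A`. -/
noncomputable def ballIn {X : Type*} [MetricSpace X] (A : Finset X) (v : X) (r : ℝ) :
    Finset X :=
  A.filter (fun y => dist v y ≤ r)

/-- The measure of a finite subset: `μ(A) = Σ_{x ∈ A} μ(x)`. -/
def measOf {X : Type*} (μ : X → ℝ) (A : Finset X) : ℝ := ∑ x ∈ A, μ x

/-- `μ*(A) = max_{x ∈ A} μ(B_A(x, diam(A)/4))`, expressed as a supremum. -/
noncomputable def muStar {X : Type*} [MetricSpace X] (μ : X → ℝ) (A : Finset X) : ℝ :=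
  sSup ((fun x => measOf μ (ballIn A x (Metric.diam (A : Set X) / 4))) '' (A : Set X))

/-- Pigeonhole for a positive monotone sequence where at most one index is bad. -/
theorem clan_pigeon (k : ℕ) (hk : 1 ≤ k) (a : ℕ → ℝ) (ha : ∀ i, 0 < a i) (hm : Monotone a)
    (bad : ℕ → Prop) (hbad : ∀ i j, i < j → bad i → bad j → False) :
    ∃ i, i ≤ k ∧ ¬ bad i ∧ a (i + 1) ≤ a i * (a (k + 1) / a 0) ^ (1 / (k : ℝ)) := by
  classical
  by_contra hcon
  push Not at hcon
  set c : ℝ := (a (k + 1) / a 0) ^ (1 / (k : ℝ)) with hc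
  have hq : 0 < a (k + 1) / a 0 := div_pos (ha _) (ha _)
  have hcpos : 0 < c := Real.rpow_pos_of_pos hq _
  have hck : c ^ k = a (k + 1) / a 0 := by
    rw [hc, one_div]
    exact Real.rpow_inv_natCast_pow hq.le (by omega)
  have htel : ∀ n, ∏ i ∈ Finset.range n, (a (i + 1) / a i) = a n / a 0 := by
    intro n
    induction n with
    | zero => simp [(ha 0).ne']
    | succ n ih =>
      rw [Finset.prod_range_succ, ih]
      have := (ha n).ne'
      have := (ha 0).ne'
      field_simp
  obtain ⟨j, hj, hjb⟩ : ∃ j, j ≤ k ∧ ∀ i, i ≤ k → i ≠ j → ¬ bad i := by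
    by_cases h : ∃ j, j ≤ k ∧ bad j
    · obtain ⟨j, hj, hb⟩ := h
      refine ⟨j, hj, fun i _ hij hi => ?_⟩
      rcases lt_or_gt_of_ne hij with h | h
      · exact hbad _ _ h hi hb
      · exact hbad _ _ h hb hi
    · push Not at h
      exact ⟨0, by omega, fun i hi _ => h i hi⟩
  have hjm : j ∈ Finset.range (k + 1) := Finset.mem_range.2 (by omega)
  have hcard : ((Finset.range (k + 1)).erase j).card = k := by
    rw [Finset.card_erase_of_mem hjm]; simp
  have hlt : ∏ _i ∈ (Finset.range (k + 1)).erase j, c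
      < ∏ i ∈ (Finset.range (k + 1)).erase j, (a (i + 1) / a i) := by
    apply Finset.prod_lt_prod_of_nonempty
    · intro i _; exact hcpos
    · intro i hi
      rw [Finset.mem_erase, Finset.mem_range] at hi
      rw [lt_div_iff₀ (ha i), mul_comm]
      exact hcon i (by omega) (hjb i (by omega) hi.1)
    · rw [← Finset.card_pos, hcard]; omega
  rw [Finset.prod_const, hcard, hck, ← htel (k + 1),
    ← Finset.mul_prod_erase _ _ hjm] at hlt
  have h1 : 1 ≤ a (j + 1) / a j := by
    rw [one_le_div (ha j)]; exact hm (Nat.le_succ j)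
  have h2 : 0 ≤ ∏ i ∈ (Finset.range (k + 1)).erase j, (a (i + 1) / a i) :=
    Finset.prod_nonneg fun i _ => (div_pos (ha _) (ha _)).le
  nlinarith

theorem measOf_mono_clan {X : Type*} (μ : X → ℝ) (hμ : ∀ x, 1 ≤ μ x) {A B : Finset X}
    (h : A ⊆ B) : measOf μ A ≤ measOf μ B :=
  Finset.sum_le_sum_of_subset_of_nonneg h fun x _ _ => by linarith [hμ x]

/-- strengthened partition claim: there exist `v ∈ X` and
`0 < R ≤ D/2` such that with `P = B_X(v, R + D/(8(k+1)))`, `Q = B_X(v, R)` and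
`Q̄ = X ∖ Q` one has `min{μ(P), μ(Q̄)} ≤ (2/3)·μ(X)`, `diam(P) ≤ D/2`, and
`μ(P) ≤ μ(Q)·(μ*(X)/μ*(P))^{1/k}`. -/
theorem clan_partition_claim_strong
    (X : Type*) [MetricSpace X] [Fintype X] [DecidableEq X] (hX : 2 ≤ Fintype.card X)
    (μ : X → ℝ) (hμ : ∀ x, 1 ≤ μ x) (k : ℕ) (hk : 1 ≤ k) :
    ∃ (v : X) (R : ℝ),
      0 < R ∧ R ≤ Metric.diam (Set.univ : Set X) / 2 ∧
      ∀ P Q Qbar : Finset X,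
        P = ballIn Finset.univ v
          (R + Metric.diam (Set.univ : Set X) / (8 * ((k : ℝ) + 1))) →
        Q = ballIn Finset.univ v R →
        Qbar = Finset.univ \ Q →
        (min (measOf μ P) (measOf μ Qbar) ≤ 2 / 3 * measOf μ Finset.univ ∧
          Metric.diam (P : Set X) ≤ Metric.diam (Set.univ : Set X) / 2) ∧
        measOf μ P ≤ measOf μ Q * (muStar μ Finset.univ / muStar μ P) ^ (1 / (k : ℝ)) := by
  classical
  set D := Metric.diam (Set.univ : Set X) with hD
  have hnt : Nontrivial X := Fintype.one_lt_card_iff_nontrivial.1 (by omega)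
  have hDpos : 0 < D := by
    obtain ⟨x, y, hxy⟩ := exists_pair_ne X
    exact (dist_pos.2 hxy).trans_le
      (Metric.dist_le_diam_of_mem Set.finite_univ.isBounded (Set.mem_univ x) (Set.mem_univ y))
  obtain ⟨v, -, hv⟩ := Finset.exists_max_image (Finset.univ : Finset X)
    (fun x => measOf μ (ballIn Finset.univ x (D / 8))) Finset.univ_nonempty
  have hk0 : (0 : ℝ) < (k : ℝ) + 1 := by positivity
  set e : ℝ := D / (8 * ((k : ℝ) + 1)) with he
  have hepos : 0 < e := by positivity
  have hek : e * ((k : ℝ) + 1) = D / 8 := by rw [he]; field_simp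
  set r : ℕ → ℝ := fun i => D / 8 + i * e with hr
  set a : ℕ → ℝ := fun i => measOf μ (ballIn Finset.univ v (r i)) with ha
  have hball : ∀ (x : X) (s t : ℝ), s ≤ t →
      ballIn Finset.univ x s ⊆ ballIn Finset.univ x t := by
    intro x s t hst y hy
    simp only [ballIn, Finset.mem_filter, Finset.mem_univ, true_and] at hy ⊢
    exact hy.trans hst
  have hrm : Monotone r := by
    intro i j hij
    have : (i : ℝ) ≤ j := by exact_mod_cast hij
    simp only [hr]
    nlinarith
  have hrpos : ∀ i, 0 < r i := fun i => by simp only [hr]; positivity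
  have ham : Monotone a := fun i j hij => measOf_mono_clan μ hμ (hball _ _ _ (hrm hij))
  have hpos : ∀ (A : Finset X) (x : X), x ∈ A → 0 < measOf μ A := by
    intro A x hx
    exact Finset.sum_pos (fun y _ => by linarith [hμ y]) ⟨x, hx⟩
  have hapos : ∀ i, 0 < a i := fun i => hpos _ v (by simp [ballIn, (hrpos i).le])
  set T := measOf μ Finset.univ with hT
  have hTpos : 0 < T := hpos _ v (Finset.mem_univ v)
  obtain ⟨i, hik, hgood, hi⟩ := clan_pigeon k hk a hapos ham
    (fun i => 2 / 3 * T < a (i + 1) ∧ 2 / 3 * T < T - a i) (by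
      intro i j hij h1 h2
      have := ham (show i + 1 ≤ j from hij)
      linarith [h1.1, h2.2])
  have hikr : (i : ℝ) ≤ k := by exact_mod_cast hik
  have hr1 : r (i + 1) = r i + e := by simp only [hr]; push_cast; ring
  have hr2 : r (i + 1) ≤ D / 4 := by simp only [hr]; push_cast; nlinarith
  have hrk : r (k + 1) = D / 4 := by simp only [hr]; push_cast; linarith
  refine ⟨v, r i, hrpos i, by linarith, ?_⟩
  rintro P Q Qbar hP hQ rfl
  rw [← hr1] at hP
  have hPa : measOf μ P = a (i + 1) := by rw [hP]
  have hQa : measOf μ Q = a i := by rw [hQ]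
  have hdiam : Metric.diam (P : Set X) ≤ D / 2 := by
    apply Metric.diam_le_of_forall_dist_le (by linarith)
    intro x hx y hy
    rw [hP] at hx hy
    simp only [ballIn, Finset.coe_filter, Finset.mem_univ, true_and, Set.mem_setOf_eq] at hx hy
    linarith [dist_triangle_left x y v]
  refine ⟨⟨?_, hdiam⟩, ?_⟩
  · have hcomp : measOf μ (Finset.univ \ Q) = T - a i := by
      rw [← hQa]
      have := Finset.sum_sdiff (f := μ) (Finset.subset_univ Q)
      simp only [hT, measOf]
      linarith
    rw [hPa, hcomp]
    by_contra hc
    push Not at hc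
    exact hgood (lt_min_iff.1 hc)
  · rw [hPa, hQa]
    refine hi.trans (mul_le_mul_of_nonneg_left ?_ (hapos i).le)
    have hvP : v ∈ P := by rw [hP]; simp [ballIn, (hrpos (i + 1)).le]
    have hfin : ∀ A : Finset X, BddAbove
        ((fun x => measOf μ (ballIn A x (Metric.diam (A : Set X) / 4))) '' (A : Set X)) :=
      fun A => (A.finite_toSet.image _).bddAbove
    have hXs : a (k + 1) ≤ muStar μ Finset.univ := by
      refine le_csSup (hfin _) ⟨v, by simp, ?_⟩
      simp only [ha, hrk, Finset.coe_univ, ← hD]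
    have hPs : muStar μ P ≤ a 0 := by
      refine csSup_le ⟨_, v, hvP, rfl⟩ ?_
      rintro _ ⟨x, -, rfl⟩
      have h0 : a 0 = measOf μ (ballIn Finset.univ v (D / 8)) := by simp [ha, hr]
      rw [h0]
      refine le_trans (measOf_mono_clan μ hμ ?_) (hv x (Finset.mem_univ x))
      intro y hy
      simp only [ballIn, Finset.mem_filter, Finset.mem_univ, true_and] at hy ⊢
      linarith [hy.2]
    have hPpos : 0 < muStar μ P := by
      refine lt_of_lt_of_le ?_ (le_csSup (hfin P) ⟨v, hvP, rfl⟩)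
      refine hpos _ v ?_
      simp only [ballIn, Finset.mem_filter, dist_self]
      exact ⟨hvP, by positivity⟩
    apply Real.rpow_le_rpow (div_pos (hapos _) (hapos _)).le
    · exact div_le_div₀ ((hapos _).le.trans hXs) hXs hPpos hPs
    · positivity
end

section
/- There is a universal constant C > 0 such that the following holds. Let (X, d_X) be a metric space on n ≥ 2 points with aspect ratio Φ, let μ be a (≥1)-measure on X, and let k ≥ 1 be an integer. Then there exist a finite ultrametric space (U, d_U) and a clan embedding (f, χ) of (X, d_X) into (U, d_U) with multiplicative distortion 16(k+1), with path distortion at most C·k·(1 + min{log₂ n, log₂ Φ}), and such that Σ_{x∈X} μ(x)·|f(x)| ≤ μ(X)^{1+1/k}. -/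
/-- A metric space satisfies the strong (ultrametric) triangle inequality. -/
def IsUltrametricSpace (U : Type*) [iU : MetricSpace U] : Prop :=
  ∀ x y z : U, dist x z ≤ max (dist x y) (dist y z)

/-- A dominating one-to-many embedding: each point has a nonempty clan, clans are
pairwise disjoint, and distances between copies dominate the original distances. -/
def IsDominatingOneToMany (X Y : Type*) [iX : MetricSpace X] [iY : MetricSpace Y]
    (f : X → Finset Y) : Prop :=
  (∀ x, (f x).Nonempty) ∧
  (∀ x y : X, x ≠ y → Disjoint (f x) (f y)) ∧
  (∀ x y : X, x ≠ y → ∀ x' ∈ f x, ∀ y' ∈ f y, dist x y ≤ dist x' y')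

/-- A clan embedding `(f, χ)` with multiplicative distortion `t`. -/
def IsClanEmbedding (X Y : Type*) [iX : MetricSpace X] [iY : MetricSpace Y]
    (f : X → Finset Y) (χ : X → Y) (t : ℝ) : Prop :=
  IsDominatingOneToMany X Y f ∧
  (∀ x, χ x ∈ f x) ∧
  (∀ x y : X, ∃ y' ∈ f y, dist y' (χ x) ≤ t * dist x y)

/-- `f` has path distortion `t`: for every finite sequence of points there are copies
whose total path length is at most `t` times the original path length. -/
def HasPathDistortion (X Y : Type*) [iX : MetricSpace X] [iY : MetricSpace Y]
    (f : X → Finset Y) (t : ℝ) : Prop :=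
  ∀ (m : ℕ) (x : ℕ → X), ∃ x' : ℕ → Y,
    (∀ i, i ≤ m → x' i ∈ f (x i)) ∧
    ∑ i ∈ Finset.range m, dist (x' i) (x' (i + 1)) ≤
      t * ∑ i ∈ Finset.range m, dist (x i) (x (i + 1))

/-- The aspect ratio of a metric space: diameter divided by the minimal positive
distance. -/
noncomputable def aspectRatio (X : Type*) [MetricSpace X] : ℝ :=
  Metric.diam (Set.univ : Set X) / sInf {d : ℝ | ∃ x y : X, x ≠ y ∧ d = dist x y}

namespace ClanEmb
set_option linter.unusedSectionVars false
open MeasureTheory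

section gap
variable {X : Type} [MetricSpace X] [Fintype X]

/-- Thickened set of distance values from `x`. -/
def thick (τ : ℝ) (x : X) : Set ℝ := ⋃ w : X, Set.Icc (dist x w) (dist x w + τ)

noncomputable def gap (τ : ℝ) (x y z : X) : ℝ :=
  volume.real (Set.uIoc (dist x y) (dist x z) \ thick τ x)

lemma uIoc_fin (a b : ℝ) (S : Set ℝ) : volume (Set.uIoc a b \ S) ≠ ⊤ := by
  refine ne_top_of_le_ne_top ?_ (measure_mono Set.sdiff_subset)
  rw [Set.uIoc]; simp

/-- The contracted pseudometric. -/
noncomputable def cd (τ : ℝ) (y z : X) : ℝ := ⨆ x, gap τ x y z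

lemma gap_le_cd (τ : ℝ) (x y z : X) : gap τ x y z ≤ cd τ y z :=
  le_ciSup (f := fun x => gap τ x y z) (Set.finite_range _).bddAbove x

lemma cd_le {τ : ℝ} {y z : X} {c : ℝ} (h : ∀ x, gap τ x y z ≤ c) : cd τ y z ≤ c := by
  have : Nonempty X := ⟨y⟩
  exact ciSup_le h

lemma gap_nonneg (τ : ℝ) (x y z : X) : 0 ≤ gap τ x y z := measureReal_nonneg

lemma cd_nonneg (τ : ℝ) (y z : X) : 0 ≤ cd τ y z :=
  (gap_nonneg τ y y z).trans (gap_le_cd τ y y z)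

lemma cd_self (τ : ℝ) (y : X) : cd τ y y = 0 := by
  apply le_antisymm _ (cd_nonneg τ y y)
  apply cd_le; intro x
  simp [gap]

lemma cd_symm (τ : ℝ) (y z : X) : cd τ y z = cd τ z y := by
  simp [cd, gap, Set.uIoc_comm]

lemma uIoc_sub (a b c : ℝ) : Set.uIoc a c ⊆ Set.uIoc a b ∪ Set.uIoc b c := by
  intro t ht
  simp only [Set.mem_union, Set.mem_uIoc] at ht ⊢
  grind

lemma cd_tri (τ : ℝ) (y z w : X) : cd τ y w ≤ cd τ y z + cd τ z w := by
  apply cd_le; intro x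
  refine le_trans ?_ (add_le_add (gap_le_cd τ x y z) (gap_le_cd τ x z w))
  unfold gap
  refine le_trans (measureReal_mono (s₂ := (Set.uIoc (dist x y) (dist x z) \ thick τ x) ∪
    (Set.uIoc (dist x z) (dist x w) \ thick τ x)) ?_ ?_) (measureReal_union_le _ _)
  · rw [← Set.union_sdiff_distrib]
    exact Set.sdiff_subset_sdiff_left (uIoc_sub _ _ _)
  · exact (measure_union_lt_top (uIoc_fin _ _ _).lt_top (uIoc_fin _ _ _).lt_top).ne

lemma vol_uIoc (a b : ℝ) : volume.real (Set.uIoc a b) = |b - a| := by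
  rw [Set.uIoc, Real.volume_real_Ioc_of_le (by simp)]
  exact max_sub_min_eq_abs a b

lemma cd_le_dist (τ : ℝ) (y z : X) : cd τ y z ≤ dist y z := by
  apply cd_le; intro x
  unfold gap
  refine le_trans (measureReal_mono Set.sdiff_subset (by simp)) ?_
  rw [vol_uIoc, dist_comm x z, dist_comm x y]
  rw [abs_sub_comm]
  exact abs_dist_sub_le y z x

lemma cd_zero {τ : ℝ} {y z : X} (h : dist y z ≤ τ) : cd τ y z ≤ 0 := by
  apply cd_le; intro x
  unfold gap
  have : Set.uIoc (dist x y) (dist x z) \ thick τ x = ∅ := by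
    rw [Set.sdiff_eq_empty]
    intro t ht
    rw [Set.mem_uIoc] at ht
    have h1 := dist_triangle x y z
    have h2 := dist_triangle x z y
    rw [dist_comm z y] at h2
    rcases ht with ht | ht
    · exact Set.mem_iUnion.2 ⟨y, ht.1.le, by linarith [ht.2]⟩
    · exact Set.mem_iUnion.2 ⟨z, ht.1.le, by linarith [ht.2]⟩
  rw [this]; simp

lemma vol_thick {τ : ℝ} (hτ : 0 ≤ τ) (x : X) : volume.real (thick τ x) ≤ Fintype.card X * τ := by
  unfold thick
  refine le_trans (measureReal_iUnion_fintype_le _) ?_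
  simp [Real.volume_real_Icc, hτ]

lemma thick_fin (τ : ℝ) (x : X) : volume (thick τ x) ≠ ⊤ := by
  unfold thick
  refine ne_top_of_le_ne_top ?_ (measure_iUnion_fintype_le _ _)
  simp [Real.volume_Icc, ENNReal.mul_eq_top]

lemma dist_le_cd {τ : ℝ} (hτ : 0 ≤ τ) (y z : X) : dist y z ≤ cd τ y z + Fintype.card X * τ := by
  refine le_trans ?_ (add_le_add (gap_le_cd τ y y z) (vol_thick hτ y))
  have h : dist y z = volume.real (Set.uIoc (dist y y) (dist y z)) := by
    rw [vol_uIoc]; simp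
  rw [h]
  unfold gap
  refine le_trans (measureReal_mono (s₂ := (Set.uIoc (dist y y) (dist y z) \ thick τ y) ∪
    thick τ y) ?_ ?_) (measureReal_union_le _ _)
  · rw [Set.sdiff_union_self]; exact Set.subset_union_left
  · exact (measure_union_lt_top (uIoc_fin _ _ _).lt_top (thick_fin _ _).lt_top).ne

lemma cd_mono {τ τ' : ℝ} (h : τ' ≤ τ) (y z : X) : cd τ y z ≤ cd τ' y z := by
  apply cd_le; intro x
  refine le_trans ?_ (gap_le_cd τ' x y z)
  unfold gap
  refine measureReal_mono (Set.sdiff_subset_sdiff_right ?_) (uIoc_fin _ _ _)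
  unfold thick
  exact Set.iUnion_mono fun w => Set.Icc_subset_Icc_right (by linarith)
end gap

section scale
variable {X : Type} [Fintype X]
open Classical in
noncomputable def bm (μ : X → ℝ) (ρ : X → X → ℝ) (R : ℝ) (Y : Finset X) : ℝ :=
  ⨆ v, ∑ y ∈ Y with ρ v y ≤ R, μ y

open Classical in
lemma le_bm (μ : X → ℝ) (ρ : X → X → ℝ) (R : ℝ) (Y : Finset X) (v : X) :
    ∑ y ∈ Y with ρ v y ≤ R, μ y ≤ bm μ ρ R Y :=
  le_ciSup (f := fun v => ∑ y ∈ Y with ρ v y ≤ R, μ y) (Set.finite_range _).bddAbove v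

lemma bm_mono [Nonempty X] {μ : X → ℝ} (hμ : ∀ x, 1 ≤ μ x) {ρ ρ' : X → X → ℝ}
    (h : ∀ x y, ρ' x y ≤ ρ x y) {R R' : ℝ} (hR : R ≤ R') {Y Y' : Finset X} (hY : Y ⊆ Y') :
    bm μ ρ R Y ≤ bm μ ρ' R' Y' := by
  classical
  refine ciSup_le fun v => le_trans ?_ (le_bm μ ρ' R' Y' v)
  apply Finset.sum_le_sum_of_subset_of_nonneg
  · intro y hy
    simp only [Finset.mem_filter] at hy ⊢
    exact ⟨hY hy.1, (h v y).trans (hy.2.trans hR)⟩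
  · intro i _ _; linarith [hμ i]

lemma bm_nonneg [Nonempty X] {μ : X → ℝ} (hμ : ∀ x, 1 ≤ μ x) (ρ : X → X → ℝ) (R : ℝ)
    (Y : Finset X) : 0 ≤ bm μ ρ R Y := by
  classical
  exact (Finset.sum_nonneg fun i _ => by linarith [hμ i]).trans
    (le_bm μ ρ R Y (Classical.arbitrary X))

lemma bm_le [Nonempty X] {μ : X → ℝ} (hμ : ∀ x, 1 ≤ μ x) (ρ : X → X → ℝ) (R : ℝ)
    (Y : Finset X) : bm μ ρ R Y ≤ ∑ x ∈ Y, μ x := by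
  classical
  exact ciSup_le fun v => Finset.sum_le_sum_of_subset_of_nonneg (Finset.filter_subset _ _)
    (fun i _ _ => by linarith [hμ i])

lemma one_le_bm {μ : X → ℝ} (hμ : ∀ x, 1 ≤ μ x) {ρ : X → X → ℝ} (h0 : ∀ x, ρ x x = 0)
    {R : ℝ} (hR : 0 ≤ R) {Y : Finset X} (hY : Y.Nonempty) : 1 ≤ bm μ ρ R Y := by
  classical
  obtain ⟨x, hx⟩ := hY
  refine le_trans (hμ x) (le_trans ?_ (le_bm μ ρ R Y x))
  exact Finset.single_le_sum (f := μ) (fun i _ => by linarith [hμ i]) (by simp [hx, h0, hR])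

lemma step_exists {k : ℕ} (hk : 1 ≤ k) (m : ℕ → ℝ) (h0 : 0 < m 0) {b : ℝ}
    (hb : 0 < b) (hm : m k ≤ b) :
    ∃ j < k, m (j+1) * (m 0) ^ (1/(k:ℝ)) ≤ m j * b ^ (1/(k:ℝ)) := by
  by_contra! hc
  set α := (m 0) ^ (1/(k:ℝ)) with hα
  set β := b ^ (1/(k:ℝ)) with hβ
  have hα0 : 0 < α := Real.rpow_pos_of_pos h0 _
  have hβ0 : 0 < β := Real.rpow_pos_of_pos hb _
  have key : ∀ j < k, m 0 * β^(j+1) < m (j+1) * α^(j+1) := by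
    intro j
    induction j with
    | zero => intro h; simpa using hc 0 h
    | succ j ih =>
      intro h
      have h1 := ih (by omega)
      have h2 := hc (j+1) h
      calc m 0 * β^(j+1+1) = (m 0 * β^(j+1)) * β := by ring
        _ < (m (j+1) * α^(j+1)) * β := by gcongr
        _ = (m (j+1) * β) * α^(j+1) := by ring
        _ < (m (j+1+1) * α) * α^(j+1) := by gcongr
        _ = _ := by ring
  have h1 := key (k-1) (by omega)
  rw [Nat.sub_add_cancel hk] at h1
  have e1 : α ^ k = m 0 := by
    rw [hα, one_div, Real.rpow_inv_natCast_pow h0.le (by omega)]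
  have e2 : β ^ k = b := by
    rw [hβ, one_div, Real.rpow_inv_natCast_pow hb.le (by omega)]
  rw [e1, e2] at h1
  nlinarith

lemma pigeon (B : ℕ → Finset X) (hB : ∀ j, B j ⊆ B (j+1)) (h0 : (B 0).Nonempty) :
    ∃ j < Fintype.card X, B j = B (j+1) := by
  by_contra! hc
  have key : ∀ j ≤ Fintype.card X, j + 1 ≤ (B j).card := by
    intro j
    induction j with
    | zero => intro _; simpa using h0.card_pos
    | succ j ih =>
      intro h
      have := Finset.card_lt_card ((hB j).ssubset_of_ne (hc j (by omega)))
      have := ih (by omega)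
      omega
  have := key _ le_rfl
  have := (B (Fintype.card X)).card_le_univ
  omega

lemma one_scale {ρ : X → X → ℝ} (h0 : ∀ x, ρ x x = 0) (hs : ∀ x y, ρ x y = ρ y x)
    (ht : ∀ x y z, ρ x z ≤ ρ x y + ρ y z) {μ : X → ℝ} (hμ : ∀ x, 1 ≤ μ x)
    {k k' : ℕ} (hk : 1 ≤ k) (hk' : k' = min k (Fintype.card X)) (hk1 : 1 ≤ k')
    {R : ℝ} (hR : 0 < R) : ∀ (N : ℕ) (Y : Finset X), Y.card ≤ N →
    ∃ (F : Finset (Finset X)) (π : X → Finset X),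
      (∀ C ∈ F, C ⊆ Y ∧ ∃ v, ∀ y ∈ C, ρ v y ≤ R) ∧
      (∀ x ∈ Y, π x ∈ F ∧ ∀ y ∈ Y, ρ x y ≤ R / (4 * k') → y ∈ π x) ∧
      ∑ C ∈ F, (∑ x ∈ C, μ x) * bm μ ρ (R/2) C ^ (1/(k:ℝ)) ≤
        (∑ x ∈ Y, μ x) * bm μ ρ R Y ^ (1/(k:ℝ)) := by
  classical
  intro N
  induction N with
  | zero =>
    intro Y hY
    have : Y = ∅ := by simpa using hY
    subst this
    exact ⟨∅, fun _ => ∅, by simp, by simp, by simp⟩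
  | succ N ih =>
    intro Y hY
    rcases Y.eq_empty_or_nonempty with rfl | hYn
    · exact ⟨∅, fun _ => ∅, by simp, by simp, by simp⟩
    have : Nonempty X := ⟨hYn.choose⟩
    have hμ0 : ∀ x, 0 ≤ μ x := fun x => by linarith [hμ x]
    obtain ⟨v, hv⟩ := exists_eq_ciSup_of_finite (f := fun v => ∑ y ∈ Y with ρ v y ≤ R/2, μ y)
    change _ = bm μ ρ (R/2) Y at hv
    set r := R / (4 * k') with hr
    have hk0 : (0:ℝ) < k' := by exact_mod_cast hk1
    have hr0 : 0 < r := by positivity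
    set B : ℕ → Finset X := fun j => Y.filter fun y => ρ v y ≤ R/2 + j * (2*r) with hB
    have hB0 : ∑ y ∈ B 0, μ y = bm μ ρ (R/2) Y := by rw [← hv]; simp [hB]
    have ha1 : 1 ≤ bm μ ρ (R/2) Y := one_le_bm hμ h0 (by linarith) hYn
    have hB0n : (B 0).Nonempty := by
      rw [Finset.nonempty_iff_ne_empty]; intro h; rw [h] at hB0; simp at hB0; linarith
    have hBm : ∀ i j, i ≤ j → B i ⊆ B j := by
      intro i j hij y hy
      simp only [hB, Finset.mem_filter] at hy ⊢
      refine ⟨hy.1, hy.2.trans ?_⟩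
      gcongr
    set b := bm μ ρ R Y with hb
    have hab : bm μ ρ (R/2) Y ≤ b := bm_mono hμ (fun _ _ => le_rfl) (by linarith) subset_rfl
    have hBR : ∀ j ≤ k', ∀ y ∈ B j, ρ v y ≤ R := by
      intro j hj y hy
      simp only [hB, Finset.mem_filter] at hy
      refine hy.2.trans ?_
      have : (j:ℝ) * (2*r) ≤ k' * (2*r) := by gcongr
      have e : (k':ℝ) * (2*r) = R/2 := by rw [hr]; field_simp; norm_num
      linarith
    have hBb : ∑ y ∈ B k', μ y ≤ b := by
      refine le_trans ?_ (le_bm μ ρ R Y v)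
      apply Finset.sum_le_sum_of_subset_of_nonneg
      · intro y hy
        simp only [Finset.mem_filter]
        exact ⟨(Finset.mem_filter.1 hy).1, hBR k' le_rfl y hy⟩
      · intro i _ _; exact hμ0 i
    have hstep : ∃ j < k', (∑ y ∈ B (j+1), μ y) * bm μ ρ (R/2) Y ^ (1/(k:ℝ)) ≤
        (∑ y ∈ B j, μ y) * b ^ (1/(k:ℝ)) := by
      rcases le_or_gt k (Fintype.card X) with h | h
      · have : k' = k := by omega
        rw [this] at hBb ⊢
        have := step_exists hk (fun j => ∑ y ∈ B j, μ y) (by simp only [hB0]; linarith)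
          (b := b) (by linarith) hBb
        simpa only [hB0] using this
      · have : k' = Fintype.card X := by omega
        rw [this]
        obtain ⟨j, hj, e⟩ := pigeon B (fun j => hBm j (j+1) (by omega)) hB0n
        refine ⟨j, hj, ?_⟩
        rw [← e]
        exact mul_le_mul_of_nonneg_left (Real.rpow_le_rpow (by linarith) hab (by positivity))
          (Finset.sum_nonneg fun i _ => hμ0 i)
    obtain ⟨j, hj, hjs⟩ := hstep
    have hBY : ∀ i, B i ⊆ Y := fun i => Finset.filter_subset _ _
    have hcard : (Y \ B j).card ≤ N := by
      have : (Y \ B j).card < Y.card := by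
        apply Finset.card_lt_card
        refine Finset.sdiff_ssubset (hBY j) (hB0n.mono (hBm 0 j (by omega)))
      omega
    obtain ⟨F, π, hF1, hF2, hF3⟩ := ih _ hcard
    refine ⟨insert (B (j+1)) F, fun x => if ρ v x ≤ R/2 + j * (2*r) + r then B (j+1) else π x,
      ?_, ?_, ?_⟩
    · intro C hC
      rw [Finset.mem_insert] at hC
      rcases hC with rfl | hC
      · exact ⟨hBY _, v, hBR _ (by omega)⟩
      · exact ⟨(hF1 C hC).1.trans Finset.sdiff_subset, (hF1 C hC).2⟩
    · intro x hx
      by_cases hc : ρ v x ≤ R/2 + j * (2*r) + r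
      · simp only [hc, if_true, Finset.mem_insert_self, true_and]
        intro y hy hxy
        simp only [hB, Finset.mem_filter]
        refine ⟨hy, ?_⟩
        have := ht v x y
        push_cast
        linarith
      · simp only [hc, if_false]
        have hx' : x ∈ Y \ B j := by
          simp only [hB, Finset.mem_sdiff, Finset.mem_filter, not_and, not_le]
          exact ⟨hx, fun _ => by linarith⟩
        refine ⟨Finset.mem_insert_of_mem (hF2 x hx').1, fun y hy hxy => (hF2 x hx').2 y ?_ hxy⟩
        simp only [hB, Finset.mem_sdiff, Finset.mem_filter, not_and, not_le]
        refine ⟨hy, fun _ => ?_⟩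
        have := ht v y x
        rw [hs y x] at this
        linarith
    · have hg : ∀ C : Finset X, 0 ≤ (∑ x ∈ C, μ x) * bm μ ρ (R/2) C ^ (1/(k:ℝ)) := fun C =>
        mul_nonneg (Finset.sum_nonneg fun i _ => hμ0 i) (Real.rpow_nonneg (bm_nonneg hμ _ _ _) _)
      have h1 : ∑ C ∈ insert (B (j+1)) F, (∑ x ∈ C, μ x) * bm μ ρ (R/2) C ^ (1/(k:ℝ)) ≤
          (∑ x ∈ B (j+1), μ x) * bm μ ρ (R/2) (B (j+1)) ^ (1/(k:ℝ)) +
          ∑ C ∈ F, (∑ x ∈ C, μ x) * bm μ ρ (R/2) C ^ (1/(k:ℝ)) := by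
        by_cases hm : B (j+1) ∈ F
        · rw [Finset.insert_eq_of_mem hm]; linarith [hg (B (j+1))]
        · rw [Finset.sum_insert hm]
      have h2 : (∑ x ∈ B (j+1), μ x) * bm μ ρ (R/2) (B (j+1)) ^ (1/(k:ℝ)) ≤
          (∑ x ∈ B (j+1), μ x) * bm μ ρ (R/2) Y ^ (1/(k:ℝ)) :=
        mul_le_mul_of_nonneg_left (Real.rpow_le_rpow (bm_nonneg hμ _ _ _)
          (bm_mono hμ (fun _ _ => le_rfl) le_rfl (hBY _)) (by positivity))
          (Finset.sum_nonneg fun i _ => hμ0 i)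
      have h3 : (∑ x ∈ Y \ B j, μ x) * bm μ ρ R (Y \ B j) ^ (1/(k:ℝ)) ≤
          (∑ x ∈ Y \ B j, μ x) * b ^ (1/(k:ℝ)) :=
        mul_le_mul_of_nonneg_left (Real.rpow_le_rpow (bm_nonneg hμ _ _ _)
          (bm_mono hμ (fun _ _ => le_rfl) le_rfl Finset.sdiff_subset) (by positivity))
          (Finset.sum_nonneg fun i _ => hμ0 i)
      have h4 : ∑ x ∈ Y \ B j, μ x + ∑ x ∈ B j, μ x = ∑ x ∈ Y, μ x := Finset.sum_sdiff (hBY j)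
      rw [← h4, add_mul]
      linarith
end scale
end ClanEmb

namespace ClanEmb
section tree
set_option linter.unusedSectionVars false
lemma sum_biUnion_le' {ι α : Type} [DecidableEq α] (s : Finset ι) (t : ι → Finset α)
    (f : α → ℝ) (hf : ∀ a, 0 ≤ f a) : ∑ a ∈ s.biUnion t, f a ≤ ∑ i ∈ s, ∑ a ∈ t i, f a := by
  classical
  induction s using Finset.induction_on with
  | empty => simp
  | insert i s hi ih =>
    rw [Finset.biUnion_insert, Finset.sum_insert hi]
    have := Finset.sum_union_inter (s₁ := t i) (s₂ := s.biUnion t) (f := f)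
    have h2 : 0 ≤ ∑ a ∈ t i ∩ s.biUnion t, f a := Finset.sum_nonneg fun _ _ => hf _
    linarith

open Classical in
/-- First-difference ultrametric on a set of sequences. -/
@[reducible] noncomputable def treeMetric {α : Type} (S : Finset (ℕ → α)) (E : ℕ → ℝ) (hE : Antitone E)
    (h0 : ∀ i, 0 < E i) : MetricSpace S where
  dist s t := if s = t then 0 else E (PiNat.firstDiff s.1 t.1)
  dist_self s := by simp
  dist_comm s t := by simp only [PiNat.firstDiff_comm, eq_comm]
  dist_triangle s t u := by
    by_cases h1 : s = u
    · subst h1; simp only [if_true]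
      split_ifs <;> first | positivity | (have := h0 (PiNat.firstDiff s.1 t.1); have := h0 (PiNat.firstDiff t.1 s.1); linarith)
    by_cases h2 : s = t
    · subst h2; simp
    by_cases h3 : t = u
    · subst h3; simp
    simp only [h1, h2, h3, if_false]
    have h := PiNat.min_firstDiff_le s.1 t.1 u.1 (fun h => h1 (Subtype.ext h))
    have := hE h
    have a := h0 (PiNat.firstDiff s.1 t.1)
    have b := h0 (PiNat.firstDiff t.1 u.1)
    rcases min_choice (PiNat.firstDiff s.1 t.1) (PiNat.firstDiff t.1 u.1) with e | e <;>
      rw [e] at this <;> linarith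
  eq_of_dist_eq_zero := by
    intro s t h
    by_contra hc
    simp only [hc, if_false] at h
    exact (h0 _).ne' h

lemma treeMetric_ultra {α : Type} (S : Finset (ℕ → α)) (E : ℕ → ℝ) (hE : Antitone E)
    (h0 : ∀ i, 0 < E i) : @IsUltrametricSpace S (treeMetric S E hE h0) := by
  classical
  intro s t u
  change (if s = u then 0 else E (PiNat.firstDiff s.1 u.1)) ≤
    max (if s = t then 0 else E (PiNat.firstDiff s.1 t.1))
      (if t = u then 0 else E (PiNat.firstDiff t.1 u.1))
  by_cases h1 : s = u
  · subst h1; simp only [if_true]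
    apply le_max_of_le_left
    split_ifs
    · exact le_rfl
    · exact (h0 _).le
  by_cases h2 : s = t
  · subst h2; simp
  by_cases h3 : t = u
  · subst h3; simp
  simp only [h1, h2, h3, if_false]
  have h := PiNat.min_firstDiff_le s.1 t.1 u.1 (fun h => h1 (Subtype.ext h))
  have := hE h
  rcases min_choice (PiNat.firstDiff s.1 t.1) (PiNat.firstDiff t.1 u.1) with e | e <;>
    rw [e] at this
  · exact le_max_of_le_left this
  · exact le_max_of_le_right this

variable {X : Type} [Fintype X]

def ext (s : ℕ → Finset X) (j : ℕ) (C : Finset X) : ℕ → Finset X := fun i => if i ≤ j then s i else C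

open Classical in
noncomputable def Ch (F : ℕ → Finset X → Finset (Finset X)) : ℕ → Finset (ℕ → Finset X)
  | 0 => {fun _ => Finset.univ}
  | j+1 => (Ch F j).biUnion fun s => (F j (s j)).image (ext s j)

lemma mem_Ch (F : ℕ → Finset X → Finset (Finset X)) (L : ℕ) (s : ℕ → Finset X) :
    s ∈ Ch F L ↔ s 0 = Finset.univ ∧ (∀ j < L, s (j+1) ∈ F j (s j)) ∧ ∀ i, L ≤ i → s i = s L := by
  classical
  induction L generalizing s with
  | zero =>
    simp only [Ch, Finset.mem_singleton]
    constructor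
    · rintro rfl; simp
    · rintro ⟨h1, -, h2⟩; funext i; rw [h2 i (by omega), h1]
  | succ L ih =>
    simp only [Ch, Finset.mem_biUnion, Finset.mem_image]
    constructor
    · rintro ⟨t, ht, C, hC, rfl⟩
      obtain ⟨h1, h2, h3⟩ := (ih t).1 ht
      refine ⟨by simp [ext, h1], ?_, ?_⟩
      · intro j hj
        rcases Nat.lt_succ_iff_lt_or_eq.1 hj with h | rfl
        · have := h2 j h
          simpa [ext, show j + 1 ≤ L by omega, show j ≤ L by omega] using this
        · simpa [ext] using hC
      · intro i hi
        simp [ext, show ¬ i ≤ L by omega]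
    · rintro ⟨h1, h2, h3⟩
      refine ⟨ext s L (s L), (ih _).2 ⟨by simp [ext, h1], ?_, ?_⟩, s (L+1), ?_, ?_⟩
      · intro j hj
        have := h2 j (by omega)
        simpa [ext, show j + 1 ≤ L by omega, show j ≤ L by omega] using this
      · intro i hi
        simp only [ext, le_refl, if_true]
        split_ifs with h
        · rw [show i = L by omega]
        · rfl
      · simpa [ext] using h2 L (by omega)
      · funext i
        simp only [ext]
        split_ifs with h
        · rfl
        · exact (h3 i (by omega)).symm

lemma sum_Ch_succ (F : ℕ → Finset X → Finset (Finset X)) (L : ℕ) (g : Finset X → ℝ)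
    (hg : ∀ C, 0 ≤ g C) :
    ∑ s ∈ Ch F (L+1), g (s (L+1)) ≤ ∑ s ∈ Ch F L, ∑ C ∈ F L (s L), g C := by
  classical
  simp only [Ch]
  refine (sum_biUnion_le' (Ch F L) (fun s => (F L (s L)).image (ext s L))
    (fun s => g (s (L+1))) (fun _ => hg _)).trans ?_
  apply Finset.sum_le_sum
  intro s _
  rw [Finset.sum_image]
  · simp [ext]
  · intro C _ C' _ h
    simpa [ext] using congrFun h (L+1)

open Classical in
noncomputable def follow (π : ℕ → Finset X → X → Finset X) (s : ℕ → Finset X) (y : X) :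
    ℕ → Finset X
  | 0 => Finset.univ
  | j+1 => if follow π s y j = s j ∧ y ∈ s (j+1) then s (j+1) else π j (follow π s y j) y

noncomputable def foll (π : ℕ → Finset X → X → Finset X) (L : ℕ) (s : ℕ → Finset X) (y : X) :
    ℕ → Finset X := fun i => follow π s y (min i L)

variable {π : ℕ → Finset X → X → Finset X} {F : ℕ → Finset X → Finset (Finset X)} {L : ℕ}

lemma mem_follow (hπ : ∀ j Y, ∀ x ∈ Y, π j Y x ∈ F j Y ∧ x ∈ π j Y x)
    (s : ℕ → Finset X) (y : X) (j : ℕ) : y ∈ follow π s y j := by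
  induction j with
  | zero => simp [follow]
  | succ j ih =>
    simp only [follow]
    split_ifs with h
    · exact h.2
    · exact (hπ j _ y ih).2

lemma foll_mem_Ch (hπ : ∀ j Y, ∀ x ∈ Y, π j Y x ∈ F j Y ∧ x ∈ π j Y x)
    (s : ℕ → Finset X) (hs : ∀ j < L, ∀ y ∈ s (j+1), s (j+1) ∈ F j (s j)) (y : X) :
    foll π L s y ∈ Ch F L := by
  rw [mem_Ch]
  refine ⟨by simp [foll, follow], ?_, ?_⟩
  · intro j hj
    simp only [foll, show min (j+1) L = j+1 by omega, show min j L = j by omega, follow]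
    split_ifs with h
    · rw [h.1]; exact hs j hj y h.2
    · exact (hπ j _ y (mem_follow hπ s y j)).1
  · intro i hi
    simp [foll, hi]

lemma foll_succ (s : ℕ → Finset X) (y : X) {j : ℕ} (hj : j < L) :
    (foll π L s y j = s j ∧ y ∈ s (j+1) ∧ foll π L s y (j+1) = s (j+1)) ∨
    ((foll π L s y j ≠ s j ∨ y ∉ s (j+1)) ∧ foll π L s y (j+1) = π j (foll π L s y j) y) := by
  simp only [foll, show min (j+1) L = j+1 by omega, show min j L = j by omega, follow]
  split_ifs with h
  · exact Or.inl ⟨h.1, h.2, rfl⟩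
  · right; exact ⟨by tauto, rfl⟩

lemma mem_foll (hπ : ∀ j Y, ∀ x ∈ Y, π j Y x ∈ F j Y ∧ x ∈ π j Y x)
    (s : ℕ → Finset X) (y : X) (j : ℕ) : y ∈ foll π L s y j := mem_follow hπ s y _

lemma Ch_antitone (hF : ∀ j Y, ∀ C ∈ F j Y, C ⊆ Y) {s : ℕ → Finset X} (hs : s ∈ Ch F L) :
    Antitone s := by
  rw [mem_Ch] at hs
  apply antitone_nat_of_succ_le
  intro j
  rcases lt_or_ge j L with h | h
  · exact hF _ _ _ (hs.2.1 j h)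
  · rw [hs.2.2 j h, hs.2.2 (j+1) (by omega)]

lemma first_diff {E : ℕ → ℝ} (hE : Antitone E) (h0 : ∀ i, 0 < E i) (s t : Ch F L) (hst : s ≠ t) :
    ∃ j < L, s.1 j = t.1 j ∧ s.1 (j+1) ≠ t.1 (j+1) ∧
      (treeMetric (Ch F L) E hE h0).dist s t = E (j+1) := by
  classical
  have hne : s.1 ≠ t.1 := fun h => hst (Subtype.ext h)
  have hs := (mem_Ch F L s.1).1 s.2
  have ht := (mem_Ch F L t.1).1 t.2
  have h1 := PiNat.apply_firstDiff_ne hne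
  have h2 : PiNat.firstDiff s.1 t.1 ≠ 0 := by
    intro h; rw [h, hs.1, ht.1] at h1; exact h1 rfl
  obtain ⟨j, hj⟩ := Nat.exists_eq_succ_of_ne_zero h2
  have hd : (treeMetric (Ch F L) E hE h0).dist s t = E (j+1) := by
    change (if s = t then 0 else E (PiNat.firstDiff s.1 t.1)) = _
    rw [if_neg hst, hj]
  have hlt : ∀ i ≤ j, s.1 i = t.1 i := fun i hi =>
    PiNat.apply_eq_of_lt_firstDiff (x := s.1) (y := t.1) (by omega)
  rw [hj] at h1
  refine ⟨j, ?_, hlt j le_rfl, h1, hd⟩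
  by_contra hc
  apply h1
  rw [hs.2.2 (j+1) (by omega), ht.2.2 (j+1) (by omega)]
  exact hlt L (by omega)

end tree
end ClanEmb

namespace ClanEmb
section main
set_option linter.unusedSectionVars false

theorem tree_main {X : Type} [MetricSpace X] [Fintype X] {D r : ℕ → ℝ} {ρ : ℕ → X → X → ℝ}
    {F : ℕ → Finset X → Finset (Finset X)} {π : ℕ → Finset X → X → Finset X} {L : ℕ} {T K : ℝ}
    (hDa : Antitone D) (hD0 : ∀ i, 0 < D i) (hr : ∀ i, 0 < r i) (hDr : ∀ j, D j ≤ T * r j)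
    (hT : 0 ≤ T)
    (hF : ∀ j Y, ∀ C ∈ F j Y, C ⊆ Y ∧ ∀ x ∈ C, ∀ y ∈ C, dist x y ≤ D (j+1))
    (hdiam : ∀ x y : X, dist x y ≤ D 0)
    (hπ : ∀ j Y, ∀ x ∈ Y, π j Y x ∈ F j Y ∧ ∀ y ∈ Y, ρ j x y ≤ r j → y ∈ π j Y x)
    (hρ0 : ∀ j x, ρ j x x = 0) (hρn : ∀ j x y, 0 ≤ ρ j x y)
    (hρt : ∀ j x y z, ρ j x z ≤ ρ j x y + ρ j y z) (hρd : ∀ j x y, ρ j x y ≤ dist x y)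
    (hL : ∀ x y : X, x ≠ y → D L < dist x y)
    (hK : ∀ x y : X, ∑ j ∈ Finset.range L, (if dist x y ≤ D j then ρ j x y else 0) ≤ K * dist x y) :
    ∃ (U : Type) (_ : MetricSpace U) (_ : Fintype U) (f : X → Finset U) (χ : X → U),
      IsUltrametricSpace U ∧ IsClanEmbedding X U f χ T ∧ HasPathDistortion X U f (T * K) ∧
      ∀ μ : X → ℝ, ∑ x, μ x * ((f x).card : ℝ) = ∑ s ∈ Ch F L, ∑ x ∈ s L, μ x := by
  classical
  have hEa : Antitone (fun i => D (i-1)) := fun i j hij => hDa (by omega)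
  have hE0 : ∀ i, 0 < (fun i => D (i-1)) i := fun i => hD0 _
  let MU : MetricSpace (Ch F L) := treeMetric (Ch F L) (fun i => D (i-1)) hEa hE0
  have hπ' : ∀ j Y, ∀ x ∈ Y, π j Y x ∈ F j Y ∧ x ∈ π j Y x := fun j Y x hx =>
    ⟨(hπ j Y x hx).1, (hπ j Y x hx).2 x hx (by rw [hρ0]; exact (hr j).le)⟩
  have hfd : ∀ s t : Ch F L, s ≠ t → ∃ j < L, s.1 j = t.1 j ∧ s.1 (j+1) ≠ t.1 (j+1) ∧
      dist s t = D j := by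
    intro s t hst
    obtain ⟨j, h1, h2, h3, h4⟩ := first_diff hEa hE0 s t hst
    exact ⟨j, h1, h2, h3, by simpa using h4⟩
  have hCh : ∀ s : Ch F L, _ := fun s => (mem_Ch F L s.1).1 s.2
  have hanti : ∀ s : Ch F L, Antitone s.1 := fun s => Ch_antitone (fun j Y C hC => (hF j Y C hC).1) s.2
  have hcl : ∀ s : Ch F L, ∀ j ≤ L, ∀ x ∈ s.1 j, ∀ y ∈ s.1 j, dist x y ≤ D j := by
    intro s j hj x hx y hy
    rcases j with _ | j
    · exact hdiam x y
    · exact (hF j _ _ ((hCh s).2.1 j (by omega))).2 x hx y hy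
  let fol : Ch F L → X → Ch F L := fun s y => ⟨foll π L s.1 y, foll_mem_Ch hπ' s.1
    (fun j hj _ _ => (hCh s).2.1 j hj) y⟩
  let χ : X → Ch F L := fun x => ⟨foll π L (fun _ => ∅) x, foll_mem_Ch hπ' _ (by simp) x⟩
  let f : X → Finset (Ch F L) := fun x => Finset.univ.filter fun s => x ∈ s.1 L
  have hmf : ∀ x (s : Ch F L), s ∈ f x ↔ x ∈ s.1 L := by intro x s; simp [f]
  have hχ : ∀ x j, j < L → (χ x).1 (j+1) = π j ((χ x).1 j) x := by
    intro x j hj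
    rcases foll_succ (π := π) (L := L) (fun _ => ∅) x hj with h | h
    · simp at h
    · exact h.2
  have hχm : ∀ x j, x ∈ (χ x).1 j := fun x j => mem_foll hπ' _ x j
  have hfolm : ∀ s x j, x ∈ (fol s x).1 j := fun s x j => mem_foll hπ' _ x j
  refine ⟨Ch F L, MU, inferInstance, f, χ, treeMetric_ultra _ _ _ _, ⟨⟨?_, ?_, ?_⟩, ?_, ?_⟩, ?_, ?_⟩
  · intro x; exact ⟨χ x, (hmf _ _).2 (hχm x L)⟩
  · intro x y hxy
    rw [Finset.disjoint_left]
    intro s hs hs'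
    rw [hmf] at hs hs'
    exact absurd (hcl s L le_rfl x hs y hs') (not_le.2 (hL x y hxy))
  · intro x y hxy s hs t ht
    rw [hmf] at hs ht
    by_cases hst : s = t
    · subst hst
      exact absurd (hcl s L le_rfl x hs y ht) (not_le.2 (hL x y hxy))
    · obtain ⟨j, hj, h1, h2, h3⟩ := hfd s t hst
      rw [h3]
      apply hcl s j hj.le x (hanti s hj.le hs)
      rw [h1]; exact hanti t hj.le ht
  · intro x; exact (hmf _ _).2 (hχm x L)
  · intro x y
    refine ⟨fol (χ x) y, (hmf _ _).2 (hfolm _ y L), ?_⟩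
    by_cases hst : fol (χ x) y = χ x
    · rw [hst, dist_self]; positivity
    · obtain ⟨j, hj, h1, h2, h3⟩ := hfd _ _ hst
      rw [h3]
      rcases foll_succ (π := π) (L := L) (χ x).1 y hj with h | h
      · exact absurd h.2.2 h2
      · have hy : y ∉ (χ x).1 (j+1) := by
          rcases h.1 with h | h
          · exact absurd h1 h
          · exact h
        rw [hχ x j hj] at hy
        have hyY : y ∈ (χ x).1 j := by rw [← h1]; exact hfolm _ y j
        have hρr : r j < ρ j x y := by
          by_contra hc
          exact hy ((hπ j _ x (hχm x j)).2 y hyY (not_lt.1 hc))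
        exact (hDr j).trans (mul_le_mul_of_nonneg_left (hρr.le.trans (hρd j x y)) hT)
  · intro m x
    let p : ℕ → Ch F L := fun i => Nat.rec (χ (x 0)) (fun i q => fol q (x (i+1))) i
    have hp0 : p 0 = χ (x 0) := rfl
    have hps : ∀ i, p (i+1) = fol (p i) (x (i+1)) := fun i => rfl
    have hpm : ∀ i j, x i ∈ (p i).1 j := by
      intro i j
      cases i with
      | zero => exact hχm _ _
      | succ i => exact hfolm _ _ _
    refine ⟨p, fun i _ => (hmf _ _).2 (hpm i L), ?_⟩
    let sw : ℕ → ℕ → Prop := fun j e => (p e).1 j = (p (e+1)).1 j ∧ (p e).1 (j+1) ≠ (p (e+1)).1 (j+1)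
    have hdist : ∀ e, dist (p e) (p (e+1)) ≤ ∑ j ∈ Finset.range L, D j * (if sw j e then 1 else 0) := by
      intro e
      have hnn : ∀ j ∈ Finset.range L, 0 ≤ D j * (if sw j e then (1:ℝ) else 0) := by
        intro j _; have := hD0 j; positivity
      rcases eq_or_ne (p e) (p (e+1)) with hst | hst
      · rw [dist_eq_zero.2 hst]; exact Finset.sum_nonneg hnn
      · obtain ⟨j, hj, h1, h2, h3⟩ := hfd _ _ hst
        rw [h3]
        refine le_trans ?_ (Finset.single_le_sum hnn (Finset.mem_range.2 hj))
        rw [if_pos ⟨h1, h2⟩, mul_one]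
    let c : ℕ → ℕ → ℝ := fun j e => if dist (x e) (x (e+1)) ≤ D j then ρ j (x e) (x (e+1)) else 0
    have hc0 : ∀ j e, 0 ≤ c j e := by
      intro j e; simp only [c]; split_ifs
      · exact hρn _ _ _
      · exact le_rfl
    have inv : ∀ j < L, ∀ m, ∃ a ∈ (p m).1 j, (p m).1 (j+1) = π j ((p m).1 j) a ∧
        r j * (∑ e ∈ Finset.range m, (if sw j e then (1:ℝ) else 0)) + ρ j a (x m) ≤
          ∑ e ∈ Finset.range m, c j e := by
      intro j hj m
      induction m with
      | zero => exact ⟨x 0, hpm 0 j, hχ _ j hj, by simp [hρ0]⟩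
      | succ m ih =>
        obtain ⟨a, ha, haπ, hle⟩ := ih
        rw [Finset.sum_range_succ, Finset.sum_range_succ, mul_add]
        have hce : (p m).1 j = (p (m+1)).1 j → c j m = ρ j (x m) (x (m+1)) := by
          intro h
          simp only [c]
          rw [if_pos]
          apply hcl (p m) j hj.le _ (hpm m j)
          rw [h]; exact hpm (m+1) j
        have htri := hρt j a (x m) (x (m+1))
        rcases foll_succ (π := π) (L := L) (p m).1 (x (m+1)) hj with h | h
        · have h1 : (p (m+1)).1 j = (p m).1 j := h.1
          have h2 : (p (m+1)).1 (j+1) = (p m).1 (j+1) := h.2.2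
          refine ⟨a, by rw [h1]; exact ha, by rw [h2, h1]; exact haπ, ?_⟩
          rw [if_neg (fun h' : sw j m => h'.2 h2.symm), hce h1.symm]
          linarith
        · have h2 : (p (m+1)).1 (j+1) = π j ((p (m+1)).1 j) (x (m+1)) := h.2
          refine ⟨x (m+1), hpm _ _, h2, ?_⟩
          rw [hρ0]
          by_cases hsw : sw j m
          · rw [if_pos hsw, hce hsw.1]
            have hy : x (m+1) ∉ (p m).1 (j+1) := by
              rcases h.1 with h | h
              · exact absurd hsw.1.symm h
              · exact h
            have : r j < ρ j a (x (m+1)) := by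
              by_contra hc
              apply hy
              rw [haπ]
              refine (hπ j _ a ha).2 _ ?_ (not_lt.1 hc)
              rw [hsw.1]; exact hpm _ _
            linarith
          · rw [if_neg hsw]
            have := hc0 j m
            have := hρn j a (x m)
            linarith
    calc ∑ e ∈ Finset.range m, dist (p e) (p (e+1))
        ≤ ∑ e ∈ Finset.range m, ∑ j ∈ Finset.range L, D j * (if sw j e then 1 else 0) :=
          Finset.sum_le_sum fun e _ => hdist e
      _ = ∑ j ∈ Finset.range L, D j * ∑ e ∈ Finset.range m, (if sw j e then (1:ℝ) else 0) := by
          rw [Finset.sum_comm]; simp only [Finset.mul_sum]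
      _ ≤ ∑ j ∈ Finset.range L, T * ∑ e ∈ Finset.range m, c j e := by
          apply Finset.sum_le_sum
          intro j hj
          obtain ⟨a, _, _, h⟩ := inv j (Finset.mem_range.1 hj) m
          have hN : 0 ≤ ∑ e ∈ Finset.range m, (if sw j e then (1:ℝ) else 0) :=
            Finset.sum_nonneg fun e _ => by positivity
          have h1 := mul_le_mul_of_nonneg_right (hDr j) hN
          have h2 : r j * (∑ e ∈ Finset.range m, (if sw j e then (1:ℝ) else 0)) ≤
            ∑ e ∈ Finset.range m, c j e := by linarith [hρn j a (x m)]
          have h3 := mul_le_mul_of_nonneg_left h2 hT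
          linarith
      _ = T * ∑ e ∈ Finset.range m, ∑ j ∈ Finset.range L, c j e := by
          rw [← Finset.mul_sum, Finset.sum_comm]
      _ ≤ T * ∑ e ∈ Finset.range m, K * dist (x e) (x (e+1)) := by
          apply mul_le_mul_of_nonneg_left _ hT
          exact Finset.sum_le_sum fun e _ => hK _ _
      _ = _ := by rw [← Finset.mul_sum]; ring
  · intro μ
    have h1 : ∀ x, μ x * ((f x).card : ℝ) = ∑ s : Ch F L, if x ∈ s.1 L then μ x else 0 := by
      intro x
      rw [← Finset.sum_filter, Finset.sum_const, nsmul_eq_mul, mul_comm]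
    simp only [h1]
    rw [Finset.sum_comm, ← Finset.sum_coe_sort (Ch F L)]
    apply Finset.sum_congr rfl
    intro s _
    rw [← Finset.sum_filter]
    simp

lemma card_le_of_diff (J : Finset ℕ) {B : ℝ} (hB : 0 ≤ B)
    (h : ∀ i ∈ J, ∀ j ∈ J, i ≤ j → (j:ℝ) - i ≤ B) : (J.card : ℝ) ≤ B + 1 := by
  rcases J.eq_empty_or_nonempty with rfl | hJ
  · simp; linarith
  have hsub : J ⊆ Finset.Icc (J.min' hJ) (J.max' hJ) := fun j hj =>
    Finset.mem_Icc.2 ⟨J.min'_le j hj, J.le_max' j hj⟩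
  have h1 := Finset.card_le_card hsub
  rw [Nat.card_Icc] at h1
  have hle : J.min' hJ ≤ J.max' hJ := J.min'_le_max' hJ
  have h2 := h _ (J.min'_mem hJ) _ (J.max'_mem hJ) hle
  have h3 : J.card + J.min' hJ ≤ J.max' hJ + 1 := by omega
  have h4 : (J.card : ℝ) + J.min' hJ ≤ J.max' hJ + 1 := by exact_mod_cast h3
  linarith

lemma card_le_of_bdd (J : Finset ℕ) {B : ℝ} (hB : 0 ≤ B)
    (h : ∀ j ∈ J, (j:ℝ) ≤ B) : (J.card : ℝ) ≤ B + 1 := by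
  apply card_le_of_diff J hB
  intro i _ j hj _
  have := h j hj
  have : (0:ℝ) ≤ i := by positivity
  linarith

end main
end ClanEmb

namespace ClanEmb
section final
lemma path_mono {X Y : Type} [MetricSpace X] [MetricSpace Y] {f : X → Finset Y} {t t' : ℝ}
    (h : t ≤ t') (hf : HasPathDistortion X Y f t) : HasPathDistortion X Y f t' := by
  intro m x
  obtain ⟨x', h1, h2⟩ := hf m x
  exact ⟨x', h1, h2.trans (mul_le_mul_of_nonneg_right h (Finset.sum_nonneg fun _ _ => dist_nonneg))⟩

theorem main_bound (X : Type) [MetricSpace X] [Fintype X] (hn : 2 ≤ Fintype.card X)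
    (μ : X → ℝ) (hμ : ∀ x, 1 ≤ μ x) (k : ℕ) (hk : 1 ≤ k) :
    ∃ (U : Type) (_ : MetricSpace U) (_ : Fintype U)
        (f : X → Finset U) (χ : X → U),
        IsUltrametricSpace U ∧
        IsClanEmbedding X U f χ (16 * ((k : ℝ) + 1)) ∧
        HasPathDistortion X U f
          (128 * (k : ℝ) *
            (1 + min (Real.logb 2 (Fintype.card X)) (Real.logb 2 (aspectRatio X)))) ∧
        ∑ x, μ x * ((f x).card : ℝ) ≤ (∑ x, μ x) ^ (1 + 1 / (k : ℝ)) := by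
  classical
  set n := Fintype.card X with hnd
  have hnt : Nontrivial X := Fintype.one_lt_card_iff_nontrivial.1 (by omega)
  obtain ⟨x0, y0, hxy0⟩ := exists_pair_ne X
  have hn2 : (2:ℝ) ≤ n := by exact_mod_cast hn
  have hn0 : (0:ℝ) < n := by linarith
  set Δ := Metric.diam (Set.univ : Set X) with hΔ
  have hdΔ : ∀ x y : X, dist x y ≤ Δ := fun x y =>
    Metric.dist_le_diam_of_mem (Set.toFinite _).isBounded (Set.mem_univ _) (Set.mem_univ _)
  have hΔ0 : 0 < Δ := (dist_pos.2 hxy0).trans_le (hdΔ _ _)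
  set S := {d : ℝ | ∃ x y : X, x ≠ y ∧ d = dist x y} with hS
  have hSf : S.Finite := by
    refine (Set.finite_range (fun q : X × X => dist q.1 q.2)).subset ?_
    rintro d ⟨x, y, _, rfl⟩; exact ⟨(x, y), rfl⟩
  set δ := sInf S with hδ
  have hδm : δ ∈ S := Set.Nonempty.csInf_mem ⟨_, x0, y0, hxy0, rfl⟩ hSf
  have hδ0 : 0 < δ := by
    obtain ⟨x, y, h, e⟩ := hδm; rw [e]; exact dist_pos.2 h
  have hδd : ∀ x y : X, x ≠ y → δ ≤ dist x y := fun x y h =>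
    csInf_le hSf.bddBelow ⟨x, y, h, rfl⟩
  have hΦ : aspectRatio X = Δ / δ := rfl
  have hΦ1 : 1 ≤ Δ / δ := by
    rw [one_le_div hδ0]; exact (hδd _ _ hxy0).trans (hdΔ _ _)
  set k' := min k n with hk'
  have hk'1 : 1 ≤ k' := by omega
  have hk'0 : (0:ℝ) < k' := by exact_mod_cast hk'1
  have hk'k : (k':ℝ) ≤ k := by exact_mod_cast min_le_left k n
  have hk'n : (k':ℝ) ≤ n := by exact_mod_cast min_le_right k n
  let R : ℕ → ℝ := fun i => Δ / 4 / 2 ^ i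
  have hR0 : ∀ i, 0 < R i := fun i => by simp only [R]; positivity
  have hRs : ∀ i, R (i+1) = R i / 2 := fun i => by simp only [R, pow_succ]; field_simp
  let D : ℕ → ℝ := fun i => 4 * R i * (1 + 1 / n)
  let τ : ℕ → ℝ := fun i => 2 * R i / n ^ 2
  let r : ℕ → ℝ := fun i => R i / (4 * k')
  let ρ : ℕ → X → X → ℝ := fun i => cd (τ i)
  have hτ0 : ∀ i, 0 ≤ τ i := fun i => by have := hR0 i; simp only [τ]; positivity
  have hτs : ∀ i, τ (i+1) ≤ τ i := fun i => by
    simp only [τ]; rw [hRs]; have := hR0 i; gcongr; linarith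
  have hD0 : ∀ i, 0 < D i := fun i => by have := hR0 i; simp only [D]; positivity
  have hDa : Antitone D := by
    apply antitone_nat_of_succ_le
    intro i; simp only [D]; rw [hRs]; have := hR0 i; gcongr; linarith
  have hone : ∀ j (Y : Finset X), _ := fun j Y =>
    one_scale (ρ := ρ j) (cd_self (τ j)) (cd_symm (τ j)) (cd_tri (τ j)) hμ hk hk' hk'1 (hR0 j)
      Y.card Y le_rfl
  choose F π hF1 hF2 hF3 using hone
  obtain ⟨L, hL⟩ : ∃ L, D L < δ := by
    obtain ⟨L, hL⟩ := exists_pow_lt_of_lt_one (show 0 < δ / D 0 from div_pos hδ0 (hD0 0))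
      (show (1/2:ℝ) < 1 by norm_num)
    refine ⟨L, ?_⟩
    rw [lt_div_iff₀ (hD0 0)] at hL
    have : D L = (1/2)^L * D 0 := by
      simp only [D, R]; rw [one_div_pow]; field_simp
    rw [this]; exact hL
  set M := min (Real.logb 2 n) (Real.logb 2 (aspectRatio X)) with hM
  have hlogn : 0 ≤ Real.logb 2 n := Real.logb_nonneg (by norm_num) (by linarith)
  have hlogΦ : 0 ≤ Real.logb 2 (aspectRatio X) := Real.logb_nonneg (by norm_num) hΦ1
  have hM0 : 0 ≤ M := le_min hlogn hlogΦ
  have hpos : ∀ j, (0:ℝ) < 2 ^ j := fun j => by positivity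
  have hn1 : 1 / (n:ℝ) ≤ 1 := by rw [div_le_one hn0]; linarith
  have hK : ∀ x y : X, ∑ j ∈ Finset.range L, (if dist x y ≤ D j then ρ j x y else 0) ≤
      (4 * (1 + M)) * dist x y := by
    intro x y
    rcases eq_or_ne x y with rfl | hxy
    · simp [ρ, cd_self]
    have hd0 : 0 < dist x y := dist_pos.2 hxy
    set J := (Finset.range L).filter fun j => dist x y ≤ D j ∧ τ j < dist x y with hJ
    have h1 : ∑ j ∈ Finset.range L, (if dist x y ≤ D j then ρ j x y else 0) ≤ J.card * dist x y := by
      rw [← nsmul_eq_mul, ← Finset.sum_const, hJ, Finset.sum_filter]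
      apply Finset.sum_le_sum
      intro j _
      by_cases ha : dist x y ≤ D j
      · by_cases hb : τ j < dist x y
        · simp only [ha, hb, and_self, if_true]; exact cd_le_dist _ _ _
        · simp only [ha, hb, and_false, if_true, if_false]; exact cd_zero (not_lt.1 hb)
      · simp [ha]
    refine h1.trans (mul_le_mul_of_nonneg_right ?_ hd0.le)
    have c1 : (J.card:ℝ) ≤ 4 * Real.logb 2 n + 1 := by
      apply card_le_of_diff J (by positivity)
      intro i hi j hj hij
      have hi' := (Finset.mem_filter.1 hi).2.2
      have hj' := (Finset.mem_filter.1 hj).2.1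
      have h2 : τ i < D j := hi'.trans_le hj'
      obtain ⟨l, rfl⟩ := Nat.exists_eq_add_of_le hij
      have h3 : R i = R (i + l) * 2 ^ l := by simp only [R, pow_add]; field_simp
      have h4 : (2:ℝ) ^ l ≤ n ^ 4 := by
        simp only [τ, D] at h2
        rw [h3, div_lt_iff₀ (by positivity)] at h2
        have hRp := hR0 (i + l)
        have h5 : (2:ℝ)^l < 2 * (1 + 1/n) * n^2 := by
          by_contra hc
          push Not at hc
          have := mul_le_mul_of_nonneg_left hc hRp.le
          nlinarith
        have h6 : 2 * (1 + 1/(n:ℝ)) * n^2 = 2 * n * (n + 1) := by field_simp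
        rw [h6] at h5
        have h7 : (n:ℝ) + 1 ≤ n^2 := by nlinarith
        have h8 : 2 * (n:ℝ) * (n+1) ≤ n * n * n^2 := by gcongr
        calc (2:ℝ)^l ≤ n * n * n^2 := h5.le.trans h8
          _ = _ := by ring
      have h9 : (l:ℝ) ≤ Real.logb 2 ((n:ℝ)^4) := by
        rw [Real.le_logb_iff_rpow_le (by norm_num) (by positivity), Real.rpow_natCast]
        exact h4
      rw [Real.logb_pow] at h9
      push_cast at h9 ⊢
      linarith
    have c2 : (J.card:ℝ) ≤ (1 + Real.logb 2 (aspectRatio X)) + 1 := by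
      apply card_le_of_bdd J (by positivity)
      intro j hj
      have hj' := (Finset.mem_filter.1 hj).2.1
      have h2 : δ ≤ D j := (hδd x y hxy).trans hj'
      have h3 : D j * 2 ^ j = Δ * (1 + 1/n) := by simp only [D, R]; field_simp
      have h4 : (2:ℝ)^j ≤ 2 * (Δ / δ) := by
        rw [← mul_div_assoc, le_div_iff₀ hδ0]
        have h5 := mul_le_mul_of_nonneg_right h2 (hpos j).le
        have h6 : Δ * (1 + 1/n) ≤ Δ * 2 := mul_le_mul_of_nonneg_left (by linarith) hΔ0.le
        linarith
      have h9 : (j:ℝ) ≤ Real.logb 2 (2 * (Δ/δ)) := by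
        rw [Real.le_logb_iff_rpow_le (by norm_num) (by positivity), Real.rpow_natCast]
        exact h4
      rw [Real.logb_mul (by norm_num) (by positivity), Real.logb_self_eq_one (by norm_num)] at h9
      rw [hΦ]; exact h9
    rcases min_choice (Real.logb 2 n) (Real.logb 2 (aspectRatio X)) with e | e <;>
      rw [hM, e] <;> linarith
  obtain ⟨U, MU, FU, f, χ, hU1, hU2, hU3, hU4⟩ := tree_main (D := D) (r := r) (ρ := ρ) (F := F)
    (π := π) (L := L) (T := 16 * ((k:ℝ) + 1)) (K := 4 * (1 + M)) hDa hD0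
    (fun i => by have := hR0 i; simp only [r]; positivity)
    (fun j => by
      have hRp := hR0 j
      have h1 : (k':ℝ) * (1 + 1/n) ≤ k + 1 := by
        have : (k':ℝ) * (1/n) ≤ 1 := by rw [mul_one_div, div_le_one hn0]; exact hk'n
        linarith
      have h2 : 16 * ((k:ℝ)+1) * r j = 4 * R j * ((k+1)/k') := by
        simp only [r]; field_simp; norm_num
      rw [h2]
      simp only [D]
      apply mul_le_mul_of_nonneg_left _ (by positivity)
      rw [le_div_iff₀ hk'0]; linarith)
    (by positivity)
    (fun j Y C hC => by
      refine ⟨(hF1 j Y C hC).1, ?_⟩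
      obtain ⟨v, hv⟩ := (hF1 j Y C hC).2
      intro x hx y hy
      have h1 := dist_le_cd (hτ0 j) x y
      have h2 := cd_tri (τ j) x v y
      rw [cd_symm (τ j) x v] at h2
      have h3 : cd (τ j) v x ≤ R j := hv x hx
      have h4 : cd (τ j) v y ≤ R j := hv y hy
      have h5 : (Fintype.card X : ℝ) * τ j = 2 * R j * (1 / n) := by
        simp only [τ]; rw [← hnd]; field_simp
      have h6 : D (j+1) = 2 * R j + 2 * R j * (1/n) := by
        simp only [D]; rw [hRs]; ring
      rw [h6]; linarith)
    (fun x y => by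
      have h : D 0 = Δ * (1 + 1/n) := by simp only [D, R]; field_simp
      rw [h]
      have : 0 ≤ Δ * (1/n) := by positivity
      linarith [hdΔ x y])
    (fun j Y => hF2 j Y) (fun j => cd_self _) (fun j => cd_nonneg _) (fun j => cd_tri _)
    (fun j => cd_le_dist _) (fun x y h => hL.trans_le (hδd x y h)) hK
  refine ⟨U, MU, FU, f, χ, hU1, hU2, path_mono ?_ hU3, ?_⟩
  · have hk1 : (1:ℝ) ≤ k := by exact_mod_cast hk
    have : (16 * ((k:ℝ)+1)) * 4 ≤ 128 * k := by linarith
    calc 16 * ((k:ℝ)+1) * (4 * (1 + M)) = (16 * ((k:ℝ)+1)) * 4 * (1 + M) := by ring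
      _ ≤ 128 * k * (1 + M) := mul_le_mul_of_nonneg_right this (by linarith)
  · rw [hU4]
    have hμ0 : ∀ x, 0 ≤ μ x := fun x => by linarith [hμ x]
    have hsum0 : ∀ C : Finset X, 0 ≤ ∑ x ∈ C, μ x := fun C => Finset.sum_nonneg fun i _ => hμ0 i
    have hp : 0 ≤ 1/(k:ℝ) := by positivity
    let W : ℕ → ℝ := fun j => ∑ s ∈ Ch F j, (∑ x ∈ s j, μ x) * bm μ (ρ j) (R j) (s j) ^ (1/(k:ℝ))
    have hW : ∀ j, W (j+1) ≤ W j := by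
      intro j
      refine (sum_Ch_succ F j (fun C => (∑ x ∈ C, μ x) * bm μ (ρ (j+1)) (R (j+1)) C ^ (1/(k:ℝ)))
        (fun C => mul_nonneg (hsum0 C) (Real.rpow_nonneg (bm_nonneg hμ _ _ _) _))).trans ?_
      apply Finset.sum_le_sum
      intro s _
      refine le_trans (Finset.sum_le_sum fun C _ => ?_) (hF3 j (s j))
      apply mul_le_mul_of_nonneg_left _ (hsum0 C)
      apply Real.rpow_le_rpow (bm_nonneg hμ _ _ _) _ hp
      exact bm_mono hμ (fun x y => cd_mono (hτs j) x y) (hRs j).le subset_rfl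
    have hWL : W L ≤ W 0 := antitone_nat_of_succ_le hW (Nat.zero_le L)
    have hS1 : 1 ≤ ∑ x, μ x :=
      (hμ x0).trans (Finset.single_le_sum (f := μ) (fun i _ => hμ0 i) (Finset.mem_univ x0))
    have hW0 : W 0 ≤ (∑ x, μ x) ^ (1 + 1/(k:ℝ)) := by
      simp only [W, Ch, Finset.sum_singleton]
      rw [Real.rpow_add (by linarith), Real.rpow_one]
      apply mul_le_mul_of_nonneg_left _ (hsum0 _)
      exact Real.rpow_le_rpow (bm_nonneg hμ _ _ _) (bm_le hμ _ _ _) hp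
    refine le_trans ?_ (hWL.trans hW0)
    apply Finset.sum_le_sum
    intro s _
    rcases (s L).eq_empty_or_nonempty with h | h
    · simp [h]
    · apply le_mul_of_one_le_right (hsum0 _)
      exact Real.one_le_rpow (one_le_bm hμ (cd_self _) (hR0 L).le h) hp

end final
end ClanEmb

/-- clan embedding into an ultrametric with multiplicative distortion
`16(k+1)`, path distortion `≤ C·k·(1 + min{log₂ n, log₂ Φ})`, and weighted clan size
`≤ μ(X)^{1+1/k}`. -/
theorem clan_embedding_ultrametric_path_distortion :
    ∃ C : ℝ, 0 < C ∧
      ∀ (X : Type) [MetricSpace X] [Fintype X], 2 ≤ Fintype.card X →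
      ∀ μ : X → ℝ, (∀ x, 1 ≤ μ x) →
      ∀ k : ℕ, 1 ≤ k →
      ∃ (U : Type) (_ : MetricSpace U) (_ : Fintype U)
        (f : X → Finset U) (χ : X → U),
        IsUltrametricSpace U ∧
        IsClanEmbedding X U f χ (16 * ((k : ℝ) + 1)) ∧
        HasPathDistortion X U f
          (C * (k : ℝ) *
            (1 + min (Real.logb 2 (Fintype.card X)) (Real.logb 2 (aspectRatio X)))) ∧
        ∑ x, μ x * ((f x).card : ℝ) ≤ (∑ x, μ x) ^ (1 + 1 / (k : ℝ)) := by
  exact ⟨128, by norm_num, fun X _ _ hn μ hμ k hk => ClanEmb.main_bound X hn μ hμ k hk⟩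
end
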